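/- arXiv:1303.3166 — 3 statements merged into one kernel-verified Lean document; each statement's English description precedes it below -/
import Mathlib

section
/- Fix a constant c > 0. There is a constant ε > 0, independent of n and G, such that for every sufficiently large k and every c-Ramsey graph G on n = 2^k vertices, the Adversary has a strategy in the Prover–Adversary game on the CNF Clique(G) that wins against every Prover who uses at most ε²·k² memory locations. -/
open Classical
noncomputable section

/-- A clause: a finite set of literals, where a literal is a pair (variable, polarity). -/
abbrev Clause (V : Type) := Finset (V × Bool)

/-- A literal `(x, b)` is satisfied by assignment `a` iff `a x = b`. -/
def litSat {V : Type} (a : V → Bool) (l : V × Bool) : Prop := a l.1 = l.2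

/-- A clause is satisfied if some literal in it is satisfied. -/
def clauseSat {V : Type} (a : V → Bool) (C : Clause V) : Prop := ∃ l ∈ C, litSat a l

/-- A CNF formula: a set of clauses. -/
abbrev CNF (V : Type) := Set (Clause V)

/-- A CNF is satisfiable if some assignment satisfies all its clauses. -/
def Satisfiable {V : Type} (φ : CNF V) : Prop := ∃ a : V → Bool, ∀ C ∈ φ, clauseSat a C

/-- A resolution refutation of a CNF `φ`: a sequence of clauses, each either a clause of `φ`
or obtained from two earlier clauses `A ∨ x`, `B ∨ ¬x` by the resolution rule (yielding
`A ∨ B`), ending with the empty clause. -/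
structure Refutation {V : Type} [DecidableEq V] (φ : CNF V) where
  clauses : List (Clause V)
  nonempty : clauses ≠ []
  valid : ∀ i : Fin clauses.length, clauses.get i ∈ φ ∨
    ∃ j k : Fin clauses.length, j < i ∧ k < i ∧
      ∃ (x : V) (A B : Clause V),
        clauses.get j = insert (x, true) A ∧
        clauses.get k = insert (x, false) B ∧
        clauses.get i = A ∪ B
  last_empty : clauses.getLast nonempty = ∅

/-- The length of a refutation: the number of clauses in the sequence. -/
def Refutation.length {V : Type} [DecidableEq V] {φ : CNF V} (R : Refutation φ) : ℕ :=
  R.clauses.length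

/-- The width of a refutation: the maximum width (number of literals) of a clause in it. -/
def Refutation.width {V : Type} [DecidableEq V] {φ : CNF V} (R : Refutation φ) : ℕ :=
  (R.clauses.map Finset.card).foldr max 0

/-- `L(φ)`: minimum length of a resolution refutation of `φ` (`⊤` if none exists,
in particular if `φ` is satisfiable). -/
def resLength {V : Type} [DecidableEq V] (φ : CNF V) : ℕ∞ :=
  sInf {l : ℕ∞ | ∃ R : Refutation φ, (R.length : ℕ∞) = l}

/-- `W(φ)`: minimum over refutations of the maximum clause width. -/
def resWidth {V : Type} [DecidableEq V] (φ : CNF V) : ℕ :=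
  sInf {w : ℕ | ∃ R : Refutation φ, R.width = w}

/-- Treelike resolution derivations of a clause from the clauses of `φ`. -/
inductive ResTree {V : Type} [DecidableEq V] (φ : CNF V) : Clause V → Type
  | ax (C : Clause V) (h : C ∈ φ) : ResTree φ C
  | res (x : V) (A B : Clause V) :
      ResTree φ (insert (x, true) A) → ResTree φ (insert (x, false) B) → ResTree φ (A ∪ B)

/-- The length (number of clauses, i.e. nodes) of a treelike derivation. -/
def ResTree.size {V : Type} [DecidableEq V] {φ : CNF V} {C : Clause V} : ResTree φ C → ℕ
  | .ax _ _ => 1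
  | .res _ _ _ t₁ t₂ => t₁.size + t₂.size + 1

/-! ### The Prover–Adversary game -/

/-- A Prover move: query a variable, or erase (forget) a stored value. -/
inductive PMove (V : Type)
  | query (x : V)
  | forget (x : V)

/-- A history of the game: list of moves (most recent first) together with the
Adversary's answer for query moves. -/
abbrev History (V : Type) := List (PMove V × Option Bool)

/-- A Prover strategy: choose the next move given the history so far. -/
def ProverStrat (V : Type) := History V → PMove V

/-- An Adversary strategy: answer a queried variable, given the history so far. -/
def AdvStrat (V : Type) := History V → V → Bool

/-- The stored partial assignment (memory content) determined by a history. -/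
def memOf {V : Type} [DecidableEq V] : History V → V → Option Bool
  | [] => fun _ => none
  | (PMove.query x, ans) :: h => Function.update (memOf h) x ans
  | (PMove.forget x, _) :: h => Function.update (memOf h) x none

/-- The history after `t` rounds of play between strategies `P` and `A`. -/
def play {V : Type} (P : ProverStrat V) (A : AdvStrat V) : ℕ → History V
  | 0 => []
  | t + 1 =>
    let h := play P A t
    match P h with
    | PMove.query x => (PMove.query x, some (A h x)) :: h
    | PMove.forget x => (PMove.forget x, none) :: h

/-- Number of memory locations in use: number of variables with a stored value. -/
def memSize {V : Type} [Fintype V] [DecidableEq V] (h : History V) : ℕ :=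
  (Finset.univ.filter fun x => (memOf h x).isSome).card

/-- The stored partial assignment falsifies clause `C`: every literal of `C` is
assigned and falsified. -/
def falsifies {V : Type} [DecidableEq V] (h : History V) (C : Clause V) : Prop :=
  ∀ l ∈ C, memOf h l.1 = some (!l.2)

/-- The Prover has a strategy winning the game on `φ` while never storing more than `M`
values: against every Adversary, the memory stays within `M` and at some point the
stored partial assignment falsifies a clause of `φ`. -/
def ProverWinsWith {V : Type} [Fintype V] [DecidableEq V] (φ : CNF V) (M : ℝ) : Prop :=
  ∃ P : ProverStrat V, ∀ A : AdvStrat V,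
    (∀ t, (memSize (play P A t) : ℝ) ≤ M) ∧ ∃ t, ∃ C ∈ φ, falsifies (play P A t) C

/-- The Adversary has a strategy winning against every Prover who uses at most `M`
memory locations: whenever the play keeps the memory within `M`, no clause of `φ` is
ever falsified. -/
def AdversaryWinsAgainst {V : Type} [Fintype V] [DecidableEq V] (φ : CNF V) (M : ℝ) : Prop :=
  ∃ A : AdvStrat V, ∀ P : ProverStrat V,
    (∀ t, (memSize (play P A t) : ℝ) ≤ M) → ∀ t, ∀ C ∈ φ, ¬ falsifies (play P A t) C

/-! ### Ramsey graphs and the formulas `Ψ_G`, `Clique(G)` -/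

/-- A graph on `n` vertices is `c`-Ramsey if no set of `c·log₂ n` vertices forms a clique
or an independent set. -/
def IsCRamsey (c : ℝ) {n : ℕ} (G : SimpleGraph (Fin n)) : Prop :=
  ¬ ∃ T : Finset (Fin n), T.card = ⌈c * Real.logb 2 n⌉₊ ∧
      (G.IsClique (T : Set (Fin n)) ∨ Gᶜ.IsClique (T : Set (Fin n)))

/-- The number `ck` of indices. -/
def numIdx (c : ℝ) (k : ℕ) : ℕ := ⌈c * (k : ℕ)⌉₊

/-- Variables of the formula `Clique(G)`: bit `b` of the vertex assigned to index `i`. -/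
abbrev CliqueVar (c : ℝ) (k : ℕ) := Fin (numIdx c k) × Fin k

/-- Variables of `Ψ_G`: the bit variables `x^i_b` together with the extra variable `y`. -/
abbrev PsiVar (c : ℝ) (k : ℕ) := CliqueVar c k ⊕ Unit

/-- Bit `b` of the binary representation of vertex `v`. -/
def vbit {k : ℕ} (v : Fin (2 ^ k)) (b : Fin k) : Bool := Nat.testBit v.val b.val

/-- The clause `⋁_b (x^i_b ≠ v_b)`, saying that index `i` is not mapped to vertex `v`. -/
def neqClause (c : ℝ) (k : ℕ) (i : Fin (numIdx c k)) (v : Fin (2 ^ k)) :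
    Clause (CliqueVar c k) :=
  Finset.univ.image fun b : Fin k => (((i, b) : CliqueVar c k), ! vbit v b)

/-- The CNF `Clique(G)`: injectivity clauses, plus for each non-edge `{u,v}` and distinct
indices `i,j` the clause `⋁_b (x^i_b ≠ u_b) ∨ ⋁_b (x^j_b ≠ v_b)`.  It is satisfiable iff
`G` has a clique of size `ck`. -/
def CliqueCNF (c : ℝ) {k : ℕ} (G : SimpleGraph (Fin (2 ^ k))) : CNF (CliqueVar c k) :=
  {C | (∃ i j : Fin (numIdx c k), i ≠ j ∧ ∃ v : Fin (2 ^ k),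
          C = neqClause c k i v ∪ neqClause c k j v) ∨
       (∃ i j : Fin (numIdx c k), i ≠ j ∧ ∃ u v : Fin (2 ^ k), u ≠ v ∧ ¬ G.Adj u v ∧
          C = neqClause c k i u ∪ neqClause c k j v)}

/-- Lift a clause on the bit variables to the variable set of `Ψ_G`. -/
def liftClause {c : ℝ} {k : ℕ} (C : Clause (CliqueVar c k)) : Clause (PsiVar c k) :=
  C.image fun l => (Sum.inl l.1, l.2)

/-- The CNF `Ψ_G`: (1) injectivity clauses; (2) for each edge `{u,v}` and distinct `i,j`
the clause `y ∨ ⋁_b (x^i_b ≠ u_b) ∨ ⋁_b (x^j_b ≠ v_b)`; (3) for each non-edge `{u,v}` and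
distinct `i,j` the clause `¬y ∨ ⋁_b (x^i_b ≠ u_b) ∨ ⋁_b (x^j_b ≠ v_b)`. -/
def PsiCNF (c : ℝ) {k : ℕ} (G : SimpleGraph (Fin (2 ^ k))) : CNF (PsiVar c k) :=
  {C | (∃ i j : Fin (numIdx c k), i ≠ j ∧ ∃ v : Fin (2 ^ k),
          C = liftClause (neqClause c k i v ∪ neqClause c k j v)) ∨
       (∃ i j : Fin (numIdx c k), i ≠ j ∧ ∃ u v : Fin (2 ^ k), G.Adj u v ∧
          C = insert (Sum.inr (), true)
                (liftClause (neqClause c k i u ∪ neqClause c k j v))) ∨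
       (∃ i j : Fin (numIdx c k), i ≠ j ∧ ∃ u v : Fin (2 ^ k), u ≠ v ∧ ¬ G.Adj u v ∧
          C = insert (Sum.inr (), false)
                (liftClause (neqClause c k i u ∪ neqClause c k j v)))}

/-! ### Property P, density, probability -/

/-- Property P: for every `U ⊆ V(G)` with `|U| ≤ k/3` and every pattern `p` with
`|p| ≤ k/3`, some common neighbour of `U` is consistent with `p`.  A pattern is a partial
assignment `p : Fin k → Option Bool` of the `k` bits; its size is the number of assigned
bits. -/
def PropertyP {k : ℕ} (G : SimpleGraph (Fin (2 ^ k))) : Prop :=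
  ∀ U : Finset (Fin (2 ^ k)), 3 * U.card ≤ k →
    ∀ p : Fin k → Option Bool, 3 * (Finset.univ.filter fun b => (p b).isSome).card ≤ k →
      ∃ v : Fin (2 ^ k), (∀ u ∈ U, G.Adj u v) ∧
        ∀ (b : Fin k) (bit : Bool), p b = some bit → vbit v b = bit

/-- The mutual density `d(A,B) = e(A,B)/(|A|·|B|)`, where `e(A,B)` is the number of pairs
`(a,b) ∈ A × B` with `{a,b}` an edge. -/
def density {α : Type} (G : SimpleGraph α) (A B : Finset α) : ℝ :=
  (((A ×ˢ B).filter fun ab => G.Adj ab.1 ab.2).card : ℝ) / ((A.card : ℝ) * (B.card : ℝ))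

/-- The probability of the event `P` under the uniform distribution on a finite type;
the uniform distribution on `SimpleGraph (Fin n)` is exactly `G(n, 1/2)`. -/
def probOf {α : Type} [Fintype α] (P : α → Prop) : ℝ :=
  ((Finset.univ.filter P).card : ℝ) / (Fintype.card α : ℝ)

/-! ### The unary formula `Ψ'_G` -/

/-- Variables of the unary formula `Ψ'_G`: variables `p^i_v` for `i ∈ [c·log₂ n]`,
`v ∈ V(G)`, plus the extra variable `y`. -/
abbrev UnaryVar (c : ℝ) (n : ℕ) := (Fin ⌈c * Real.logb 2 n⌉₊ × Fin n) ⊕ Unit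

/-- The unary CNF `Ψ'_G`: each index is mapped to exactly one vertex, the map is
injective, and (depending on `y`) the image is a clique or an independent set. -/
def PsiUnary (c : ℝ) {n : ℕ} (G : SimpleGraph (Fin n)) : CNF (UnaryVar c n) :=
  {C | (∃ i : Fin ⌈c * Real.logb 2 n⌉₊,
          C = Finset.univ.image fun v : Fin n => ((Sum.inl (i, v) : UnaryVar c n), true)) ∨
       (∃ i : Fin ⌈c * Real.logb 2 n⌉₊, ∃ u v : Fin n, u ≠ v ∧
          C = {((Sum.inl (i, u) : UnaryVar c n), false), (Sum.inl (i, v), false)}) ∨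
       (∃ i j : Fin ⌈c * Real.logb 2 n⌉₊, i ≠ j ∧ ∃ v : Fin n,
          C = {((Sum.inl (i, v) : UnaryVar c n), false), (Sum.inl (j, v), false)}) ∨
       (∃ i j : Fin ⌈c * Real.logb 2 n⌉₊, i ≠ j ∧ ∃ u v : Fin n, G.Adj u v ∧
          C = {((Sum.inr () : UnaryVar c n), true), (Sum.inl (i, u), false),
               (Sum.inl (j, v), false)}) ∨
       (∃ i j : Fin ⌈c * Real.logb 2 n⌉₊, i ≠ j ∧ ∃ u v : Fin n, u ≠ v ∧ ¬ G.Adj u v ∧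
          C = {((Sum.inr () : UnaryVar c n), false), (Sum.inl (i, u), false),
               (Sum.inl (j, v), false)})}

end


/-- Off-diagonal Ramsey bound inside a finite set of vertices. -/
lemma aux_ramsey_choose {V : Type} (G : SimpleGraph V) (s : ℕ) :
    ∀ (t : ℕ) (S : Finset V), (s + t).choose s ≤ S.card →
      (∃ T ⊆ S, T.card = s ∧ G.IsClique (T : Set V)) ∨
      (∃ T ⊆ S, T.card = t ∧ Gᶜ.IsClique (T : Set V)) := by
  induction s with
  | zero => intro t S _; left; exact ⟨∅, by simp, by simp, by simp⟩
  | succ s ihs =>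
    intro t
    induction t with
    | zero => intro S _; right; exact ⟨∅, by simp, by simp, by simp⟩
    | succ t iht =>
      intro S hS
      have hch : (s + 1 + (t + 1)).choose (s + 1)
          = (s + (t + 1)).choose s + (s + 1 + t).choose (s + 1) := by
        rw [show s + 1 + (t + 1) = (s + (t + 1)) + 1 by ring, Nat.choose_succ_succ,
          show s + (t + 1) = s + 1 + t by ring]
      have hpos : 0 < (s + (t + 1)).choose s := Nat.choose_pos (by omega)
      have hne : S.Nonempty := by
        rw [← Finset.card_pos]; omega
      obtain ⟨v, hv⟩ := hne
      have hsplit : ((S.erase v).filter fun u => G.Adj v u).card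
          + ((S.erase v).filter fun u => ¬ G.Adj v u).card = S.card - 1 := by
        rw [Finset.card_filter_add_card_filter_not, Finset.card_erase_of_mem hv]
      by_cases h1 : (s + (t + 1)).choose s ≤ ((S.erase v).filter fun u => G.Adj v u).card
      · rcases ihs (t + 1) _ h1 with ⟨T, hT, hc, hcl⟩ | ⟨T, hT, hc, hcl⟩
        · left
          have hvT : v ∉ T := fun h => by simpa using hT h
          refine ⟨insert v T, ?_, by rw [Finset.card_insert_of_notMem hvT, hc], ?_⟩
          · intro x hx
            rcases Finset.mem_insert.1 hx with rfl | hx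
            · exact hv
            · exact Finset.mem_of_mem_erase (Finset.mem_filter.1 (hT hx)).1
          · rw [Finset.coe_insert]
            exact hcl.insert fun b hb _ => (Finset.mem_filter.1 (hT hb)).2
        · right
          exact ⟨T, fun x hx => Finset.mem_of_mem_erase (Finset.mem_filter.1 (hT hx)).1, hc, hcl⟩
      · have h2 : (s + 1 + t).choose (s + 1) ≤
            ((S.erase v).filter fun u => ¬ G.Adj v u).card := by omega
        rcases iht _ h2 with ⟨T, hT, hc, hcl⟩ | ⟨T, hT, hc, hcl⟩
        · left
          exact ⟨T, fun x hx => Finset.mem_of_mem_erase (Finset.mem_filter.1 (hT hx)).1, hc, hcl⟩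
        · right
          have hvT : v ∉ T := fun h => by simpa using hT h
          refine ⟨insert v T, ?_, by rw [Finset.card_insert_of_notMem hvT, hc], ?_⟩
          · intro x hx
            rcases Finset.mem_insert.1 hx with rfl | hx
            · exact hv
            · exact Finset.mem_of_mem_erase (Finset.mem_filter.1 (hT hx)).1
          · rw [Finset.coe_insert]
            exact hcl.insert fun b hb hne => by
              rw [SimpleGraph.compl_adj]
              exact ⟨hne, (Finset.mem_filter.1 (hT hb)).2⟩

/-- The independent-set boosting step. -/
lemma aux_step {V : Type} (G : SimpleGraph V) (S A B : Finset V) (δ m Q L a : ℝ)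
    (hind : ∀ X : Finset V, L ≤ X.card →
      ∃ T ⊆ X, a ≤ (T.card : ℝ) ∧ Gᶜ.IsClique (T : Set V))
    (hAS : A ⊆ S) (hBS : B ⊆ S) (hA : m ≤ A.card) (hB : m ≤ B.card)
    (hδ : 0 < δ) (hδ8 : δ ≤ 1 / 8) (ha : 0 < a)
    (hdeg : ∀ v ∈ B, ((A.filter fun u => G.Adj v u).card : ℝ) ≤ δ * A.card)
    (hQ : ∀ I : Finset V, Gᶜ.IsClique (I : Set V) →
      ((I.powerset.filter fun J => (J.card : ℝ) ≤ 4 * δ * I.card).card : ℝ) ≤ Q)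
    (hQ1 : 1 ≤ Q) (hL : 1 ≤ L) (hm : 4 * Q * L ≤ m) :
    ∃ T ⊆ S, 3 / 2 * a ≤ (T.card : ℝ) ∧ Gᶜ.IsClique (T : Set V) := by
  have hQL : L ≤ Q * L := by nlinarith
  have hceil : (⌈L⌉₊ : ℝ) < L + 1 := Nat.ceil_lt_add_one (by linarith)
  have hceil' : L ≤ (⌈L⌉₊ : ℝ) := Nat.le_ceil L
  obtain ⟨B', hB'B, hB'c⟩ : ∃ B' ⊆ B, B'.card = ⌈L⌉₊ := by
    apply Finset.exists_subset_card_eq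
    have : (⌈L⌉₊ : ℝ) ≤ B.card := by linarith
    exact_mod_cast this
  obtain ⟨I, hIB, hIa, hI⟩ := hind B' (by rw [hB'c]; exact hceil')
  have hIpos : (0 : ℝ) < I.card := by linarith
  set A' := A \ B' with hA'
  have hA'c : (A.card : ℝ) ≤ 2 * A'.card := by
    have h1 : A.card ≤ A'.card + B'.card := by
      have := Finset.le_card_sdiff B' A
      rw [hA']
      omega
    have h2 : (A.card : ℝ) ≤ A'.card + B'.card := by exact_mod_cast h1
    have h3 : (B'.card : ℝ) = ⌈L⌉₊ := by exact_mod_cast hB'c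
    linarith
  have hdc : ∑ u ∈ A', ((I.filter fun v => G.Adj u v).card : ℝ)
      = ∑ v ∈ I, ((A'.filter fun u => G.Adj v u).card : ℝ) := by
    have := Finset.sum_card_bipartiteAbove_eq_sum_card_bipartiteBelow (s := A') (t := I)
      (fun u v => G.Adj u v)
    simp only [Finset.bipartiteAbove, Finset.bipartiteBelow] at this
    have h2 : ∀ v, (A'.filter fun u => G.Adj v u) = A'.filter fun u => G.Adj u v := by
      intro v
      apply Finset.filter_congr
      intro u _
      exact G.adj_comm v u
    simp only [h2]
    exact_mod_cast this
  have hsum : ∑ u ∈ A', ((I.filter fun v => G.Adj u v).card : ℝ)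
      ≤ I.card * (2 * δ * A'.card) := by
    rw [hdc, ← nsmul_eq_mul]
    apply Finset.sum_le_card_nsmul
    intro v hv
    have h1 := hdeg v (hB'B (hIB hv))
    have h2 : ((A'.filter fun u => G.Adj v u).card : ℝ) ≤ (A.filter fun u => G.Adj v u).card := by
      exact_mod_cast Finset.card_le_card (Finset.filter_subset_filter _ Finset.sdiff_subset)
    nlinarith
  set A2 := A'.filter fun u => ((I.filter fun v => G.Adj u v).card : ℝ) ≤ 4 * δ * I.card with hA2
  set A3 := A'.filter fun u => ¬ ((I.filter fun v => G.Adj u v).card : ℝ) ≤ 4 * δ * I.card with hA3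
  have h23 : (A2.card : ℝ) + A3.card = A'.card := by
    exact_mod_cast Finset.card_filter_add_card_filter_not (s := A') _
  have hA3c : (A3.card : ℝ) * (4 * δ * I.card) ≤ I.card * (2 * δ * A'.card) := by
    refine le_trans ?_ hsum
    rw [← nsmul_eq_mul]
    refine le_trans (Finset.card_nsmul_le_sum A3
      (fun u => ((I.filter fun v => G.Adj u v).card : ℝ)) _ ?_) ?_
    · intro u hu
      exact (not_le.1 (Finset.mem_filter.1 hu).2).le
    · exact Finset.sum_le_sum_of_subset_of_nonneg (Finset.filter_subset _ _)
        (fun _ _ _ => by positivity)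
  have hA3d : 2 * (A3.card : ℝ) ≤ A'.card := by
    have hp : 0 < 2 * δ * I.card := by positivity
    have : (2 * δ * I.card) * (2 * (A3.card : ℝ)) ≤ (2 * δ * I.card) * A'.card := by linarith
    exact le_of_mul_le_mul_left this hp
  have hA2c : m ≤ 4 * (A2.card : ℝ) := by linarith
  obtain ⟨J, hJ, hJc⟩ := Finset.exists_le_card_fiber_of_nsmul_le_card_of_maps_to
    (s := A2) (t := I.powerset.filter fun J => (J.card : ℝ) ≤ 4 * δ * I.card)
    (f := fun u => I.filter fun v => G.Adj u v) (b := L)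
    (by
      intro u hu
      rw [Finset.mem_filter, Finset.mem_powerset]
      exact ⟨Finset.filter_subset _ _, (Finset.mem_filter.1 hu).2⟩)
    ⟨∅, by simp; positivity⟩
    (by
      rw [nsmul_eq_mul]
      have := hQ I hI
      have h4 := mul_le_mul_of_nonneg_right this (by linarith : (0:ℝ) ≤ L)
      linarith)
  obtain ⟨T, hTY, hTa, hT⟩ := hind _ hJc
  rw [Finset.mem_filter, Finset.mem_powerset] at hJ
  have hTmem : ∀ x ∈ T, x ∈ A ∧ x ∉ B' ∧ (I.filter fun v => G.Adj x v) = J := by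
    intro x hx
    have h1 := Finset.mem_filter.1 (hTY hx)
    have h2 := Finset.mem_filter.1 h1.1
    have h3 := Finset.mem_sdiff.1 h2.1
    exact ⟨h3.1, h3.2, h1.2⟩
  have hdisj : Disjoint (I \ J) T := by
    rw [Finset.disjoint_left]
    intro x hx hxT
    exact (hTmem x hxT).2.1 (hIB (Finset.mem_sdiff.1 hx).1)
  have hcross : ∀ x ∈ T, ∀ y ∈ I \ J, ¬ G.Adj x y := by
    intro x hx y hy hadj
    have h1 := Finset.mem_sdiff.1 hy
    apply h1.2
    rw [← (hTmem x hx).2.2]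
    exact Finset.mem_filter.2 ⟨h1.1, hadj⟩
  refine ⟨(I \ J) ∪ T, ?_, ?_, ?_⟩
  · intro x hx
    rcases Finset.mem_union.1 hx with hx | hx
    · exact hBS (hB'B (hIB (Finset.mem_sdiff.1 hx).1))
    · exact hAS (hTmem x hx).1
  · rw [Finset.card_union_of_disjoint hdisj]
    have h1 : I.card ≤ (I \ J).card + J.card := by
      have := Finset.le_card_sdiff J I
      omega
    have h2 : (I.card : ℝ) ≤ (I \ J).card + J.card := by exact_mod_cast h1
    push_cast
    nlinarith [hJ.2]
  · intro x hx y hy hxy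
    have hx' := Finset.mem_union.1 (Finset.mem_coe.1 hx)
    have hy' := Finset.mem_union.1 (Finset.mem_coe.1 hy)
    rcases hx' with hx' | hx' <;> rcases hy' with hy' | hy'
    · exact hI (Finset.mem_sdiff.1 hx').1 (Finset.mem_sdiff.1 hy').1 hxy
    · rw [SimpleGraph.compl_adj]
      exact ⟨hxy, fun h => hcross y hy' x hx' h.symm⟩
    · rw [SimpleGraph.compl_adj]
      exact ⟨hxy, fun h => hcross x hx' y hy' h⟩
    · exact hT hx' hy' hxy

/-- Entropy-type estimate. -/
lemma aux_entropy (D η : ℝ) (hD : 0 < D) (hη : 0 < η) :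
    ∃ y τ : ℝ, 0 < y ∧ y ≤ 1 ∧ 0 < τ ∧ τ ≤ 1 ∧ ∀ (N : ℕ) (t k : ℝ), 0 ≤ k → (N : ℝ) ≤ D * k →
      t ≤ τ * k → (1 + 2 * y) ^ N ≤ (2 : ℝ) ^ (η * k) * y ^ t := by
  have hl2 : 0 < Real.log 2 := Real.log_pos (by norm_num)
  set y : ℝ := min (1 / 2) (η * Real.log 2 / (4 * D)) with hy
  have hy0 : 0 < y := lt_min (by norm_num) (by positivity)
  have hy2 : y ≤ 1 / 2 := min_le_left _ _
  have hyD : y * (4 * D) ≤ η * Real.log 2 := by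
    have : y ≤ η * Real.log 2 / (4 * D) := min_le_right _ _
    rwa [le_div_iff₀ (by positivity)] at this
  have hly : 0 < - Real.log y := by
    have := Real.log_neg hy0 (by linarith)
    linarith
  set τ : ℝ := min 1 (η * Real.log 2 / (2 * (- Real.log y))) with hτ
  have hτ0 : 0 < τ := lt_min (by norm_num) (by positivity)
  have hτ2 : τ * (2 * (- Real.log y)) ≤ η * Real.log 2 := by
    have : τ ≤ η * Real.log 2 / (2 * (- Real.log y)) := min_le_right _ _
    rwa [le_div_iff₀ (by positivity)] at this
  refine ⟨y, τ, hy0, by linarith, hτ0, min_le_left _ _, ?_⟩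
  intro N t k hk hN ht
  have h1 : (1 + 2 * y) ^ N ≤ Real.exp (2 * y * N) := by
    have : 1 + 2 * y ≤ Real.exp (2 * y) := by
      have := Real.add_one_le_exp (2 * y); linarith
    calc (1 + 2 * y) ^ N ≤ (Real.exp (2 * y)) ^ N := by gcongr
      _ = Real.exp (2 * y * N) := by rw [← Real.exp_nat_mul]; ring_nf
  refine h1.trans ?_
  rw [Real.rpow_def_of_pos (by norm_num : (0:ℝ) < 2), Real.rpow_def_of_pos hy0, ← Real.exp_add]
  apply Real.exp_le_exp.2
  have e1 : 2 * y * N ≤ 2 * y * (D * k) := by gcongr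
  have e2 : 2 * (y * (4 * D)) * k ≤ 2 * (η * Real.log 2) * k := by gcongr
  have e3 : t * (- Real.log y) ≤ τ * k * (- Real.log y) := by gcongr
  have e4 : τ * (2 * (- Real.log y)) * k ≤ η * Real.log 2 * k := by gcongr
  nlinarith

lemma aux_subset_count {V : Type} (I : Finset V) (y x : ℝ) (hy : 0 < y) (hy1 : y ≤ 1) :
    ((I.powerset.filter fun J => (J.card : ℝ) ≤ x).card : ℝ) * y ^ x ≤ (1 + 2 * y) ^ I.card := by
  rw [← nsmul_eq_mul]
  have h1 := Finset.card_nsmul_le_sum (I.powerset.filter fun J => (J.card : ℝ) ≤ x)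
    (fun J => y ^ J.card) (y ^ x) (by
      intro J hJ
      have := (Finset.mem_filter.1 hJ).2
      rw [← Real.rpow_natCast]
      exact Real.rpow_le_rpow_of_exponent_ge hy hy1 this)
  refine h1.trans ?_
  have h2 : ∑ J ∈ I.powerset.filter (fun J => (J.card : ℝ) ≤ x), y ^ J.card
      ≤ ∑ J ∈ I.powerset, y ^ J.card :=
    Finset.sum_le_sum_of_subset_of_nonneg (Finset.filter_subset _ _)
      (fun _ _ _ => by positivity)
  refine h2.trans ?_
  have h3 := Finset.sum_pow_mul_eq_add_pow y 1 I
  simp only [one_pow, mul_one] at h3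
  rw [h3]
  exact pow_le_pow_left₀ (by positivity) (by linarith) _

lemma aux_choose_bound (s t : ℕ) (y : ℝ) (hy : 0 < y) :
    ((s + t).choose s : ℝ) * y ^ t ≤ (1 + 2 * y) ^ (s + t) := by
  have h : ((s + t).choose t : ℝ) * y ^ t ≤ (y + 1) ^ (s + t) := by
    rw [add_pow]
    have := Finset.single_le_sum (s := Finset.range (s + t + 1))
      (f := fun m => y ^ m * (1:ℝ) ^ (s + t - m) * ((s + t).choose m : ℝ))
      (fun i _ => by positivity) (Finset.mem_range.2 (by omega : t < s + t + 1))
    simp only [one_pow, mul_one] at this ⊢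
    linarith
  rw [Nat.choose_symm_add]
  refine h.trans ?_
  exact pow_le_pow_left₀ (by positivity) (by linarith) _

lemma aux_iter {V : Type} (G : SimpleGraph V) (δ Q L E a : ℝ)
    (hind : ∀ X : Finset V, L ≤ X.card →
      ∃ T ⊆ X, a ≤ (T.card : ℝ) ∧ Gᶜ.IsClique (T : Set V))
    (hδ : 0 < δ) (hδ8 : δ ≤ 1 / 8) (ha : 0 < a)
    (hQ : ∀ I : Finset V, Gᶜ.IsClique (I : Set V) →
      ((I.powerset.filter fun J => (J.card : ℝ) ≤ 4 * δ * I.card).card : ℝ) ≤ Q)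
    (hQ1 : 1 ≤ Q) (hL : 1 ≤ L) (hE : 1 ≤ E)
    (hbad : ∀ S : Finset V, L ≤ S.card → ∃ A ⊆ S, (S.card : ℝ) ≤ A.card * E ∧
      (S.card : ℝ) ≤
        (S.filter fun v => ((A.filter fun u => G.Adj v u).card : ℝ) < δ * A.card).card * E)
    (j : ℕ) :
    ∀ X : Finset V, L * (4 * Q * E) ^ j ≤ X.card →
      ∃ T ⊆ X, (3 / 2) ^ j * a ≤ (T.card : ℝ) ∧ Gᶜ.IsClique (T : Set V) := by
  have hE0 : 0 < E := by linarith
  have hR : 1 ≤ 4 * Q * E := by nlinarith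
  induction j with
  | zero => simpa using hind
  | succ j ih =>
    intro X hX
    have hRj : 1 ≤ (4 * Q * E) ^ j := one_le_pow₀ hR
    have hRj1 : 1 ≤ (4 * Q * E) ^ (j + 1) := one_le_pow₀ hR
    obtain ⟨A, hAX, hA, hB⟩ := hbad X (by nlinarith)
    have := aux_step G X A
      (X.filter fun v => ((A.filter fun u => G.Adj v u).card : ℝ) < δ * A.card)
      δ (X.card / E) Q (L * (4 * Q * E) ^ j) ((3 / 2) ^ j * a) ih hAX (Finset.filter_subset _ _)
      (by rwa [div_le_iff₀ hE0]) (by rwa [div_le_iff₀ hE0]) hδ hδ8 (by positivity)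
      (fun v hv => (Finset.mem_filter.1 hv).2.le) hQ hQ1 (by nlinarith)
      (by
        rw [le_div_iff₀ hE0]
        calc 4 * Q * (L * (4 * Q * E) ^ j) * E = L * (4 * Q * E) ^ (j + 1) := by ring
          _ ≤ _ := hX)
    obtain ⟨T, h1, h2, h3⟩ := this
    refine ⟨T, h1, ?_, h3⟩
    rw [pow_succ]
    linarith

/-- A Ramsey graph has a vertex set in which all large pairs are reasonably dense. -/
lemma aux_PR (c : ℝ) (hc : 0 < c) :
    ∃ θ δ : ℝ, 0 < θ ∧ 0 < δ ∧ δ ≤ 1 / 8 ∧ ∃ K : ℕ, ∀ k : ℕ, K ≤ k →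
      ∀ G : SimpleGraph (Fin (2 ^ k)), IsCRamsey c G →
        ∃ S : Finset (Fin (2 ^ k)), S.Nonempty ∧
          ∀ A ⊆ S, (S.card : ℝ) ≤ A.card * (2 : ℝ) ^ (θ * k) →
            ((S.filter fun v => ((A.filter fun u => G.Adj v u).card : ℝ) < δ * A.card).card : ℝ)
              * (2 : ℝ) ^ (θ * k) < S.card := by
  obtain ⟨y0, τ0, hy0, hy01, hτ0, hτ01, hent0⟩ := aux_entropy (c + 2) (1 / 2) (by linarith) (by norm_num)
  obtain ⟨h, hh⟩ : ∃ h : ℕ, (c + 1) / (τ0 / 2) < (3 / 2 : ℝ) ^ h :=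
    pow_unbounded_of_one_lt _ (by norm_num)
  have hh' : c + 1 ≤ (3 / 2 : ℝ) ^ h * (τ0 / 2) := by
    rw [div_lt_iff₀ (by positivity)] at hh
    exact hh.le
  set θ : ℝ := 1 / (6 * (h + 1)) with hθ
  have hθ0 : 0 < θ := by positivity
  have hθh : 3 * θ * h ≤ 1 / 2 := by
    rw [hθ]
    have : (0:ℝ) < h + 1 := by positivity
    field_simp
    linarith
  obtain ⟨y1, τ1, hy1, hy11, hτ1, hτ11, hent1⟩ := aux_entropy (c + 1) θ (by linarith) hθ0
  set δ : ℝ := min (1 / 8) (τ1 / (4 * (c + 1))) with hδ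
  have hδ0 : 0 < δ := lt_min (by norm_num) (by positivity)
  have hδ8 : δ ≤ 1 / 8 := min_le_left _ _
  have hδτ : δ * (4 * (c + 1)) ≤ τ1 := by
    have : δ ≤ τ1 / (4 * (c + 1)) := min_le_right _ _
    rwa [le_div_iff₀ (by positivity)] at this
  refine ⟨θ, δ, hθ0, hδ0, hδ8, max 1 (max ⌈2 / τ0⌉₊ ⌈2 / θ⌉₊), ?_⟩
  intro k hk G hG
  have hk1 : (1 : ℝ) ≤ k := by exact_mod_cast le_trans (le_max_left _ _) hk
  have hk0 : (0 : ℝ) ≤ k := by linarith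
  have hkτ : 2 ≤ τ0 * k := by
    have h1 : ⌈2 / τ0⌉₊ ≤ k := le_trans (le_trans (le_max_left _ _) (le_max_right _ _)) hk
    have h2 := Nat.ceil_le.1 h1
    rw [div_le_iff₀ hτ0] at h2
    linarith
  have hkθ : 2 ≤ θ * k := by
    have h1 : ⌈2 / θ⌉₊ ≤ k := le_trans (le_trans (le_max_right _ _) (le_max_right _ _)) hk
    have h2 := Nat.ceil_le.1 h1
    rw [div_le_iff₀ hθ0] at h2
    linarith
  set s : ℕ := ⌈c * Real.logb 2 ((2 ^ k : ℕ) : ℝ)⌉₊ with hs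
  have hsk : (s : ℝ) ≤ (c + 1) * k := by
    have hlog : Real.logb 2 ((2 ^ k : ℕ) : ℝ) = k := by
      push_cast
      rw [← Real.rpow_natCast, Real.logb_rpow (by norm_num) (by norm_num)]
    have := Nat.ceil_lt_add_one (show 0 ≤ c * Real.logb 2 ((2 ^ k : ℕ) : ℝ) by
      rw [hlog]; positivity)
    rw [← hs, hlog] at this
    linarith
  have hnocl : ∀ T : Finset (Fin (2 ^ k)), T.card = s → ¬ G.IsClique (T : Set _) :=
    fun T hT h => hG ⟨T, hT, Or.inl h⟩
  have hnoind : ∀ T : Finset (Fin (2 ^ k)), Gᶜ.IsClique (T : Set _) → T.card < s := by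
    intro T hT
    by_contra hlt
    obtain ⟨T', hT', hc'⟩ := Finset.exists_subset_card_eq (not_lt.1 hlt)
    exact hG ⟨T', hc', Or.inr (hT.subset (by exact_mod_cast hT'))⟩
  set E : ℝ := (2 : ℝ) ^ (θ * k) with hE
  have hE4 : 4 ≤ E := by
    calc (4 : ℝ) = (2 : ℝ) ^ (2 : ℝ) := by norm_num
      _ ≤ E := Real.rpow_le_rpow_of_exponent_le (by norm_num) hkθ
  by_contra hcon
  push Not at hcon
  have hbase : ∀ X : Finset (Fin (2 ^ k)), (2 : ℝ) ^ ((1 / 2 : ℝ) * k) ≤ X.card →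
      ∃ T ⊆ X, τ0 / 2 * k ≤ (T.card : ℝ) ∧ Gᶜ.IsClique (T : Set _) := by
    intro X hX
    have hfl : (⌊τ0 * k⌋₊ : ℝ) ≤ τ0 * k := Nat.floor_le (by positivity)
    have hfl' : τ0 * k < ⌊τ0 * k⌋₊ + 1 := Nat.lt_floor_add_one _
    have hch : (s + ⌊τ0 * k⌋₊).choose s ≤ X.card := by
      have h1 := aux_choose_bound s ⌊τ0 * k⌋₊ y0 hy0
      have h2 := hent0 (s + ⌊τ0 * k⌋₊) ⌊τ0 * k⌋₊ k hk0 (by push_cast; nlinarith) hfl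
      rw [Real.rpow_natCast] at h2
      have h3 := le_of_mul_le_mul_right (h1.trans h2) (by positivity)
      exact_mod_cast h3.trans hX
    rcases aux_ramsey_choose G s ⌊τ0 * k⌋₊ X hch with ⟨T, _, hT2, hT3⟩ | ⟨T, hT1, hT2, hT3⟩
    · exact absurd hT3 (hnocl T hT2)
    · refine ⟨T, hT1, ?_, hT3⟩
      rw [hT2]
      linarith
  have hL1 : (1 : ℝ) ≤ (2 : ℝ) ^ ((1 / 2 : ℝ) * k) := Real.one_le_rpow (by norm_num) (by positivity)
  have hfin := aux_iter G δ E ((2 : ℝ) ^ ((1 / 2 : ℝ) * k)) E (τ0 / 2 * k) hbase hδ0 hδ8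
    (by positivity)
    (by
      intro I hI
      have hIs : (I.card : ℝ) ≤ (c + 1) * k := by
        have : (I.card : ℝ) ≤ s := by exact_mod_cast (hnoind I hI).le
        linarith
      have h1 := aux_subset_count I y1 (4 * δ * I.card) hy1 hy11
      have h2 := hent1 I.card (4 * δ * I.card) k hk0 hIs (by
        have e1 : 4 * δ * I.card ≤ 4 * δ * ((c + 1) * k) := by gcongr
        have e2 : δ * (4 * (c + 1)) * k ≤ τ1 * k := by gcongr
        linarith)
      exact le_of_mul_le_mul_right (h1.trans h2) (by positivity))
    (by linarith) hL1 (by linarith)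
    (by
      intro S hS
      have hne : S.Nonempty := by
        rw [← Finset.card_pos]
        have : (0 : ℝ) < S.card := by linarith
        exact_mod_cast this
      obtain ⟨A, h1, h2, h3⟩ := hcon S hne
      exact ⟨A, h1, h2, h3⟩)
    h Finset.univ
    (by
      have hR : 4 * E * E ≤ (2 : ℝ) ^ (3 * θ * k) := by
        have : (2 : ℝ) ^ (3 * θ * k) = E * E * E := by
          rw [hE, ← Real.rpow_add (by norm_num), ← Real.rpow_add (by norm_num)]
          ring_nf
        rw [this]
        have : 0 < E := by linarith
        gcongr
      calc (2 : ℝ) ^ ((1 / 2 : ℝ) * k) * (4 * E * E) ^ h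
          ≤ (2 : ℝ) ^ ((1 / 2 : ℝ) * k) * ((2 : ℝ) ^ (3 * θ * k)) ^ h := by
            have : 0 < E := by linarith
            gcongr
        _ = (2 : ℝ) ^ ((1 / 2 : ℝ) * k + 3 * θ * k * h) := by
            rw [← Real.rpow_natCast, ← Real.rpow_mul (by norm_num), ← Real.rpow_add (by norm_num)]
        _ ≤ (2 : ℝ) ^ (k : ℝ) := by
            apply Real.rpow_le_rpow_of_exponent_le (by norm_num)
            nlinarith
        _ = _ := by simp)
  obtain ⟨T, _, hT, hTi⟩ := hfin
  have h1 : (T.card : ℝ) < s := by exact_mod_cast hnoind T hTi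
  nlinarith

lemma aux_pattern_count (k t : ℕ) (y : ℝ) (hy : 0 < y) (hy1 : y ≤ 1) :
    (((Finset.univ : Finset (Fin k → Option Bool)).filter fun p =>
      (Finset.univ.filter fun b => (p b).isSome).card ≤ t).card : ℝ) * y ^ t
      ≤ (1 + 2 * y) ^ k := by
  have h0 := Fintype.sum_pow (fun o : Option Bool => if o.isSome then y else (1 : ℝ)) k
  have h1 : (∑ o : Option Bool, if o.isSome then y else (1 : ℝ)) = 1 + 2 * y := by
    rw [Fintype.sum_option]
    simp
  rw [h1] at h0
  rw [h0, ← nsmul_eq_mul]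
  have h2 : ∀ p : Fin k → Option Bool, (∏ i, if (p i).isSome then y else (1 : ℝ))
      = y ^ (Finset.univ.filter fun b => (p b).isSome).card := by
    intro p
    rw [Finset.prod_ite]
    simp
  simp only [h2]
  refine le_trans (Finset.card_nsmul_le_sum _
    (fun p : Fin k → Option Bool => y ^ (Finset.univ.filter fun b => (p b).isSome).card) _ ?_)
    (Finset.sum_le_sum_of_subset_of_nonneg (Finset.filter_subset _ _)
      (fun _ _ _ => by positivity))
  intro p hp
  exact pow_le_pow_of_le_one hy.le hy1 (Finset.mem_filter.1 hp).2

lemma aux_prune {V ι : Type} (S : Finset V) (P : Finset ι) (C : ι → V → Prop) (M : ℝ)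
    (hM : 0 ≤ M) :
    ∃ U ⊆ S, (S.card : ℝ) ≤ U.card + M * P.card ∧
      ∀ p ∈ P, (∃ u ∈ U, C p u) → M ≤ (U.filter fun u => C p u).card := by
  obtain ⟨U, hU, hmax⟩ := Finset.exists_max_image S.powerset
    (fun U => (U.card : ℝ) + M * (P.filter fun p => ∀ u ∈ U, ¬ C p u).card)
    ⟨S, Finset.mem_powerset_self S⟩
  rw [Finset.mem_powerset] at hU
  refine ⟨U, hU, ?_, ?_⟩
  · have h1 := hmax S (Finset.mem_powerset_self S)
    have h2 : ((P.filter fun p => ∀ u ∈ U, ¬ C p u).card : ℝ) ≤ P.card := by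
      exact_mod_cast Finset.card_filter_le _ _
    have h3 : 0 ≤ M * ((P.filter fun p => ∀ u ∈ S, ¬ C p u).card : ℝ) := by positivity
    nlinarith
  · intro p hp ⟨u, hu, hpu⟩
    by_contra hlt
    rw [not_le] at hlt
    have h1 := hmax (U.filter fun u => ¬ C p u)
      (Finset.mem_powerset.2 ((Finset.filter_subset _ _).trans hU))
    have h2 : ((U.filter fun u => C p u).card : ℝ) + (U.filter fun u => ¬ C p u).card = U.card := by
      exact_mod_cast Finset.card_filter_add_card_filter_not (s := U) _
    have h3 : (P.filter fun p => ∀ u ∈ U, ¬ C p u).card + 1 ≤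
        (P.filter fun q => ∀ u ∈ U.filter (fun u => ¬ C p u), ¬ C q u).card := by
      have hnot : p ∉ P.filter fun p => ∀ u ∈ U, ¬ C p u :=
        fun h => (Finset.mem_filter.1 h).2 u hu hpu
      rw [← Finset.card_insert_of_notMem hnot]
      apply Finset.card_le_card
      intro q hq
      rcases Finset.mem_insert.1 hq with rfl | hq
      · exact Finset.mem_filter.2 ⟨hp, fun u hu => (Finset.mem_filter.1 hu).2⟩
      · have := Finset.mem_filter.1 hq
        exact Finset.mem_filter.2 ⟨this.1, fun u hu => this.2 u (Finset.mem_filter.1 hu).1⟩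
    have h4 : ((P.filter fun p => ∀ u ∈ U, ¬ C p u).card : ℝ) + 1 ≤
        (P.filter fun q => ∀ u ∈ U.filter (fun u => ¬ C p u), ¬ C q u).card := by
      exact_mod_cast h3
    nlinarith

/-- Vertices of `U` consistent with pattern `p` and adjacent to all of `W`. -/
noncomputable def auxA {V ι : Type} (G : SimpleGraph V) (U : Finset V) (C : ι → V → Prop)
    (p : ι) (W : Finset V) : Finset V :=
  U.filter fun u => C p u ∧ ∀ w ∈ W, G.Adj w u

/-- The invariant on the set of committed vertices. -/
def auxInv {V ι : Type} (G : SimpleGraph V) (U : Finset V) (P : Finset ι) (C : ι → V → Prop)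
    (δ M : ℝ) (W : Finset V) : Prop :=
  ∀ W' ⊆ W, ∀ p ∈ P, (∃ u ∈ U, C p u) → δ ^ W'.card * M ≤ (auxA G U C p W').card

lemma auxInv_mono {V ι : Type} {G : SimpleGraph V} {U : Finset V} {P : Finset ι}
    {C : ι → V → Prop} {δ M : ℝ} {W W₁ : Finset V} (h : auxInv G U P C δ M W) (hW : W₁ ⊆ W) :
    auxInv G U P C δ M W₁ :=
  fun W' hW' => h W' (hW'.trans hW)

lemma aux_extend {V ι : Type} [DecidableEq V] (G : SimpleGraph V) (S U : Finset V) (P : Finset ι)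
    (C : ι → V → Prop) (δ M E : ℝ) (r : ℕ) (hUS : U ⊆ S)
    (hδ : 0 < δ) (hδ1 : δ ≤ 1) (hM : 0 ≤ M) (hE : 0 < E)
    (hgood : ∀ A ⊆ S, (S.card : ℝ) ≤ A.card * E →
      ((S.filter fun v => ((A.filter fun u => G.Adj v u).card : ℝ) < δ * A.card).card : ℝ)
        * E < S.card)
    (hcond : 2 ^ r * P.card * (S.card : ℝ) < δ ^ r * M * E)
    (W : Finset V) (hW : W.card ≤ r) (hinv : auxInv G U P C δ M W)
    (p0 : ι) (hp0 : p0 ∈ P) (hp0U : ∃ u ∈ U, C p0 u) :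
    ∃ v ∈ U, C p0 v ∧ (∀ w ∈ W, G.Adj w v) ∧ auxInv G U P C δ M (insert v W) := by
  set P' := P.filter fun p => ∃ u ∈ U, C p u with hP'
  set bad : Finset V × ι → Finset V := fun q =>
    S.filter fun v => (((auxA G U C q.2 q.1).filter fun u => G.Adj v u).card : ℝ)
      < δ * (auxA G U C q.2 q.1).card with hbad
  have hPpos : (1 : ℝ) ≤ P.card := by
    exact_mod_cast Finset.card_pos.2 ⟨p0, hp0⟩
  have hpow : ∀ W' ⊆ W, δ ^ r * M ≤ δ ^ W'.card * M := by
    intro W' hW'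
    have := pow_le_pow_of_le_one hδ.le hδ1 ((Finset.card_le_card hW').trans hW)
    gcongr
  have hS : (S.card : ℝ) ≤ δ ^ r * M * E := by
    have h1 : (1 : ℝ) ≤ 2 ^ r * P.card := by
      have : (1 : ℝ) ≤ 2 ^ r := one_le_pow₀ (by norm_num)
      nlinarith
    have h2 : (0 : ℝ) ≤ S.card := by positivity
    nlinarith
  have hbadc : ∀ q ∈ W.powerset ×ˢ P', ((bad q).card : ℝ) ≤ S.card / E := by
    intro q hq
    rw [Finset.mem_product, Finset.mem_powerset, Finset.mem_filter] at hq
    have h1 := hinv q.1 hq.1 q.2 hq.2.1 hq.2.2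
    have h2 := hpow q.1 hq.1
    rw [le_div_iff₀ hE]
    refine (hgood (auxA G U C q.2 q.1) ((Finset.filter_subset _ _).trans hUS) ?_).le
    have : δ ^ r * M * E ≤ (auxA G U C q.2 q.1).card * E :=
      mul_le_mul_of_nonneg_right (h2.trans h1) hE.le
    linarith
  have hBad : ((((W.powerset ×ˢ P').biUnion bad).card : ℕ) : ℝ) < (auxA G U C p0 W).card := by
    have h1 : ((((W.powerset ×ˢ P').biUnion bad).card : ℕ) : ℝ)
        ≤ ∑ q ∈ W.powerset ×ˢ P', ((bad q).card : ℝ) := by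
      exact_mod_cast Finset.card_biUnion_le
    have h2 := Finset.sum_le_card_nsmul _ _ _ hbadc
    rw [nsmul_eq_mul, Finset.card_product, Finset.card_powerset] at h2
    push_cast at h2
    have h3 : (2 : ℝ) ^ W.card * P'.card ≤ 2 ^ r * P.card := by
      have e1 : (P'.card : ℝ) ≤ P.card := by exact_mod_cast Finset.card_filter_le _ _
      have e2 : (2 : ℝ) ^ W.card ≤ 2 ^ r := pow_le_pow_right₀ (by norm_num) hW
      gcongr
    have h4 : (2 : ℝ) ^ W.card * P'.card * (S.card / E) ≤ 2 ^ r * P.card * (S.card / E) := by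
      gcongr
    have h5 : 2 ^ r * P.card * ((S.card : ℝ) / E) < δ ^ r * M := by
      rw [← mul_div_assoc, div_lt_iff₀ hE]
      exact hcond
    have h6 := hpow W (Finset.Subset.refl W)
    have h7 := hinv W (Finset.Subset.refl W) p0 hp0 hp0U
    linarith
  obtain ⟨v, hv, hvb⟩ := Finset.exists_mem_notMem_of_card_lt_card (by exact_mod_cast hBad :
    ((W.powerset ×ˢ P').biUnion bad).card < (auxA G U C p0 W).card)
  have hv' := Finset.mem_filter.1 hv
  refine ⟨v, hv'.1, hv'.2.1, hv'.2.2, ?_⟩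
  intro W' hW' p hp hpU
  by_cases hvW : v ∈ W'
  · have hsub : W'.erase v ⊆ W := by
      intro x hx
      rcases Finset.mem_insert.1 (hW' (Finset.mem_of_mem_erase hx)) with h | h
      · exact absurd h (Finset.ne_of_mem_erase hx)
      · exact h
    have h1 : δ * (auxA G U C p (W'.erase v)).card ≤
        ((auxA G U C p (W'.erase v)).filter fun u => G.Adj v u).card := by
      by_contra hlt
      apply hvb
      rw [Finset.mem_biUnion]
      refine ⟨(W'.erase v, p), ?_, ?_⟩
      · exact Finset.mem_product.2 ⟨Finset.mem_powerset.2 hsub, Finset.mem_filter.2 ⟨hp, hpU⟩⟩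
      · exact Finset.mem_filter.2 ⟨hUS hv'.1, not_le.1 hlt⟩
    have h2 : ((auxA G U C p (W'.erase v)).filter fun u => G.Adj v u) = auxA G U C p W' := by
      ext u
      simp only [auxA, Finset.mem_filter, Finset.mem_erase]
      constructor
      · rintro ⟨⟨hu, hc, ha⟩, hvu⟩
        refine ⟨hu, hc, fun w hw => ?_⟩
        by_cases hwv : w = v
        · rw [hwv]; exact hvu
        · exact ha w ⟨hwv, hw⟩
      · rintro ⟨hu, hc, ha⟩
        exact ⟨⟨hu, hc, fun w hw => ha w hw.2⟩, ha v hvW⟩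
    rw [h2] at h1
    have h3 := hinv (W'.erase v) hsub p hp hpU
    have h4 : W'.card = (W'.erase v).card + 1 := by
      rw [Finset.card_erase_add_one hvW]
    rw [h4, pow_succ]
    nlinarith
  · refine hinv W' (fun x hx => ?_) p hp hpU
    rcases Finset.mem_insert.1 (hW' hx) with h | h
    · exact absurd (h ▸ hx) hvW
    · exact h

lemma aux_adv {V : Type} [Fintype V] [DecidableEq V] (φ : CNF V) (B : ℝ)
    (Inv : (V → Option Bool) → Prop) (h0 : Inv (fun _ => none))
    (hq : ∀ m x, Inv m → ∃ b : Bool,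
      (((Finset.univ.filter fun z => (Function.update m x (some b) z).isSome).card : ℝ) ≤ B →
        Inv (Function.update m x (some b))))
    (hf : ∀ m x, Inv m → Inv (Function.update m x none))
    (hfal : ∀ m, Inv m → ∀ C ∈ φ, ¬ ∀ l ∈ C, m l.1 = some (!l.2)) :
    AdversaryWinsAgainst φ B := by
  refine ⟨fun h x => if hI : Inv (memOf h) then (hq (memOf h) x hI).choose else true, ?_⟩
  intro P hmem
  set A : AdvStrat V :=
    fun h x => if hI : Inv (memOf h) then (hq (memOf h) x hI).choose else true with hA
  have hinv : ∀ t, Inv (memOf (play P A t)) := by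
    intro t
    induction t with
    | zero => exact h0
    | succ t ih =>
      have hm := hmem (t + 1)
      unfold memSize at hm
      cases hP : P (play P A t) with
      | query x =>
        have hplay : play P A (t + 1) =
            (PMove.query x, some (A (play P A t) x)) :: play P A t := by
          simp only [play, hP]
        have hAx : A (play P A t) x = (hq (memOf (play P A t)) x ih).choose := by
          simp only [hA]
          exact dif_pos ih
        have hmo : memOf (play P A (t + 1)) = Function.update (memOf (play P A t)) x
            (some (hq (memOf (play P A t)) x ih).choose) := by
          rw [hplay, ← hAx]
          rfl
        simp only [hmo] at hm ⊢
        exact (hq (memOf (play P A t)) x ih).choose_spec hm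
      | forget x =>
        have hplay : play P A (t + 1) = (PMove.forget x, none) :: play P A t := by
          simp only [play, hP]
        rw [hplay]
        exact hf _ x ih
  intro t C hC hfl
  exact hfal _ (hinv t) C hC hfl

/-- Indices with more than `t` stored bits. -/
noncomputable def auxHeavy {N k : ℕ} (t : ℕ) (m : Fin N × Fin k → Option Bool) : Finset (Fin N) :=
  Finset.univ.filter fun i => t < (Finset.univ.filter fun b => (m (i, b)).isSome).card

lemma auxHeavy_mono {N k : ℕ} (t : ℕ) (m m' : Fin N × Fin k → Option Bool)
    (h : ∀ z, (m z).isSome → (m' z).isSome) : auxHeavy t m ⊆ auxHeavy t m' := by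
  intro i hi
  unfold auxHeavy at *
  rw [Finset.mem_filter] at *
  refine ⟨hi.1, hi.2.trans_le (Finset.card_le_card ?_)⟩
  intro b hb
  rw [Finset.mem_filter] at *
  exact ⟨hb.1, h _ hb.2⟩

lemma auxHeavy_card {N k : ℕ} (t : ℕ) (m : Fin N × Fin k → Option Bool) :
    (auxHeavy t m).card * (t + 1) ≤ (Finset.univ.filter fun z => (m z).isSome).card := by
  have h1 : (Finset.univ.filter fun z => (m z).isSome).card
      = ∑ i, (Finset.univ.filter fun b => (m (i, b)).isSome).card := by
    simp only [Finset.card_filter]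
    rw [Fintype.sum_prod_type]
  rw [h1, ← smul_eq_mul]
  refine le_trans (Finset.card_nsmul_le_sum (auxHeavy t m)
    (fun i => (Finset.univ.filter fun b => (m (i, b)).isSome).card) _ ?_)
    (Finset.sum_le_sum_of_subset (Finset.subset_univ _))
  intro i hi
  exact (Finset.mem_filter.1 hi).2

lemma aux_vbit_inj {k : ℕ} {u v : Fin (2 ^ k)} (h : ∀ b, vbit u b = vbit v b) : u = v := by
  apply Fin.ext
  apply Nat.eq_of_testBit_eq
  intro i
  by_cases hi : i < k
  · exact h ⟨i, hi⟩
  · have h2 : 2 ^ k ≤ 2 ^ i := Nat.pow_le_pow_right (by norm_num) (not_lt.1 hi)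
    rw [Nat.testBit_lt_two_pow (u.2.trans_le h2), Nat.testBit_lt_two_pow (v.2.trans_le h2)]

lemma aux_game (c : ℝ) {k : ℕ} (G : SimpleGraph (Fin (2 ^ k))) (S : Finset (Fin (2 ^ k)))
    (hSne : S.Nonempty) (δ E B : ℝ) (t r : ℕ) (P : Finset (Fin k → Option Bool))
    (hP : P = Finset.univ.filter fun p =>
      (Finset.univ.filter fun b => (p b).isSome).card ≤ t)
    (hδ : 0 < δ) (hδ1 : δ ≤ 1) (hE : 0 < E) (htk : t < k)
    (hgood : ∀ A ⊆ S, (S.card : ℝ) ≤ A.card * E →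
      ((S.filter fun v => ((A.filter fun u => G.Adj v u).card : ℝ) < δ * A.card).card : ℝ)
        * E < S.card)
    (hcond : 2 ^ r * P.card * (S.card : ℝ) < δ ^ r * (S.card / (2 * P.card)) * E)
    (hB : ∀ n : ℕ, ((n * (t + 1) : ℕ) : ℝ) ≤ B → n ≤ r) :
    AdversaryWinsAgainst (CliqueCNF c G) B := by
  set M : ℝ := S.card / (2 * P.card) with hM
  have hPpos : (0 : ℝ) < P.card := by
    have : (fun _ => none) ∈ P := by rw [hP]; simp
    exact_mod_cast Finset.card_pos.2 ⟨_, this⟩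
  have hSpos : (0 : ℝ) < S.card := by exact_mod_cast Finset.card_pos.2 hSne
  have hM0 : 0 ≤ M := by positivity
  set C : (Fin k → Option Bool) → Fin (2 ^ k) → Prop :=
    fun p v => ∀ (b : Fin k) (bit : Bool), p b = some bit → vbit v b = bit with hC
  obtain ⟨U, hUS, hUc, hU⟩ := aux_prune S P C M hM0
  have hUne : U.Nonempty := by
    rw [← Finset.card_pos]
    have h1 : M * P.card = S.card / 2 := by
      rw [hM]; field_simp
    have : (0 : ℝ) < U.card := by linarith
    exact_mod_cast this
  obtain ⟨u0, hu0⟩ := hUne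
  have hinv0 : auxInv G U P C δ M ∅ := by
    intro W' hW' p hp hpU
    rw [Finset.subset_empty.1 hW']
    have := hU p hp hpU
    have hAe : auxA G U C p ∅ = U.filter fun u => C p u := by
      ext u
      simp only [auxA, Finset.mem_filter, Finset.notMem_empty, false_imp_iff, implies_true,
        and_true]
    rw [hAe, Finset.card_empty, pow_zero, one_mul]
    convert this
  apply aux_adv (CliqueCNF c G) B (fun m => ∃ v : Fin (numIdx c k) → Fin (2 ^ k),
    (∀ i, v i ∈ U) ∧ (∀ i, C (fun b => m (i, b)) (v i)) ∧
    (∀ i ∈ auxHeavy t m, ∀ j ∈ auxHeavy t m, i ≠ j → G.Adj (v i) (v j)) ∧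
    auxInv G U P C δ M ((auxHeavy t m).image v))
  · have hem : auxHeavy t (fun _ : Fin (numIdx c k) × Fin k => (none : Option Bool)) = ∅ := by
      simp [auxHeavy]
    refine ⟨fun _ => u0, fun _ => hu0, fun i b bit h => by simp at h, ?_, ?_⟩
    · intro i hi; rw [hem] at hi; simp at hi
    · rw [hem]; simpa using hinv0
  · rintro m ⟨i, b⟩ ⟨v, hvU, hvC, hvA, hvI⟩
    have hsome : ∀ (β : Bool) z, (Function.update m (i, b) (some β) z).isSome
        = (Function.update m (i, b) (some true) z).isSome := by
      intro β z
      by_cases hz : z = (i, b)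
      · subst hz; simp
      · simp [Function.update_of_ne hz]
    have hup : ∀ z, (m z).isSome → (Function.update m (i, b) (some true) z).isSome := by
      intro z hz
      by_cases hz' : z = (i, b)
      · subst hz'; simp
      · simpa [Function.update_of_ne hz'] using hz
    have hheq : ∀ β : Bool, auxHeavy t (Function.update m (i, b) (some β))
        = auxHeavy t (Function.update m (i, b) (some true)) := by
      intro β
      apply Finset.Subset.antisymm <;> apply auxHeavy_mono <;> intro z hz
      · rwa [← hsome β z]
      · rwa [hsome β z]
    set H' := auxHeavy t (Function.update m (i, b) (some true)) with hH'
    have hHH' : auxHeavy t m ⊆ H' := auxHeavy_mono _ _ _ hup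
    have hH'i : ∀ j ∈ H', j ≠ i → j ∈ auxHeavy t m := by
      intro j hj hji
      have hj2 := (Finset.mem_filter.1 hj).2
      refine Finset.mem_filter.2 ⟨Finset.mem_univ _, hj2.trans_eq ?_⟩
      congr 1
      apply Finset.filter_congr
      intro b' _
      rw [Function.update_of_ne (by simp [hji])]
    have hcons : ∀ w : Fin (numIdx c k) → Fin (2 ^ k), (∀ j, C (fun b => m (j, b)) (w j)) →
        ∀ j, C (fun b' => Function.update m (i, b) (some (vbit (w i) b)) (j, b')) (w j) := by
      intro w hw j b' bit hbit
      by_cases hz : (j, b') = (i, b)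
      · obtain ⟨rfl, rfl⟩ := Prod.mk.inj hz
        simpa using hbit
      · simp only [Function.update_of_ne hz] at hbit
        exact hw j b' bit hbit
    by_cases hcase : i ∈ auxHeavy t m ∨ i ∉ H'
    · refine ⟨vbit (v i) b, fun _ => ⟨v, hvU, hcons v hvC, ?_⟩⟩
      have hEq : H' = auxHeavy t m := by
        apply Finset.Subset.antisymm _ hHH'
        intro j hj
        by_cases hji : j = i
        · subst hji
          rcases hcase with h | h
          · exact h
          · exact absurd hj h
        · exact hH'i j hj hji
      rw [hheq, hEq]
      exact ⟨hvA, hvI⟩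
    · push Not at hcase
      obtain ⟨hi1, hi2⟩ := hcase
      by_cases hsz : ((Finset.univ.filter fun z =>
          (Function.update m (i, b) (some true) z).isSome).card : ℝ) ≤ B
      · have hr : ((auxHeavy t m).image v).card ≤ r := by
          refine Finset.card_image_le.trans ((Finset.card_le_card hHH').trans ?_)
          apply hB
          refine le_trans ?_ hsz
          exact_mod_cast auxHeavy_card t _
        have hpP : (fun b => m (i, b)) ∈ P := by
          rw [hP]
          refine Finset.mem_filter.2 ⟨Finset.mem_univ _, ?_⟩
          by_contra hlt
          exact hi1 (Finset.mem_filter.2 ⟨Finset.mem_univ _, not_le.1 hlt⟩)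
        obtain ⟨w, hwU, hwC, hwA, hwI⟩ := aux_extend G S U P C δ M E r hUS hδ hδ1 hM0 hE hgood
          hcond _ hr hvI (fun b => m (i, b)) hpP ⟨v i, hvU i, hvC i⟩
        set v' := Function.update v i w with hv'
        have hv'i : v' i = w := by simp [hv']
        have hv'j : ∀ j, j ≠ i → v' j = v j := fun j hj => by simp [hv', hj]
        refine ⟨vbit (v' i) b, fun _ => ⟨v', ?_, hcons v' ?_, ?_, ?_⟩⟩
        · intro j
          by_cases hji : j = i
          · rw [hji, hv'i]; exact hwU
          · rw [hv'j j hji]; exact hvU j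
        · intro j
          by_cases hji : j = i
          · rw [hji, hv'i]; exact hwC
          · rw [hv'j j hji]; exact hvC j
        · rw [hheq]
          intro j hj l hl hjl
          by_cases hji : j = i
          · have hli : l ≠ i := fun h => hjl (hji.trans h.symm)
            rw [hji, hv'i, hv'j l hli]
            exact (hwA _ (Finset.mem_image_of_mem v (hH'i l hl hli))).symm
          · by_cases hli : l = i
            · rw [hli, hv'i, hv'j j hji]
              exact hwA _ (Finset.mem_image_of_mem v (hH'i j hj hji))
            · rw [hv'j j hji, hv'j l hli]
              exact hvA j (hH'i j hj hji) l (hH'i l hl hli) hjl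
        · rw [hheq]
          refine auxInv_mono hwI ?_
          intro x hx
          obtain ⟨j, hj, rfl⟩ := Finset.mem_image.1 hx
          by_cases hji : j = i
          · rw [hji, hv'i]; exact Finset.mem_insert_self _ _
          · rw [hv'j j hji]
            exact Finset.mem_insert_of_mem (Finset.mem_image_of_mem v (hH'i j hj hji))
      · exact ⟨true, fun h => absurd h hsz⟩
  · rintro m ⟨i, b⟩ ⟨v, hvU, hvC, hvA, hvI⟩
    have hsub : auxHeavy t (Function.update m (i, b) none) ⊆ auxHeavy t m := by
      apply auxHeavy_mono
      intro z hz
      by_cases hz' : z = (i, b)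
      · subst hz'; simp at hz
      · simpa [Function.update_of_ne hz'] using hz
    refine ⟨v, hvU, ?_, fun j hj l hl => hvA j (hsub hj) l (hsub hl),
      auxInv_mono hvI (Finset.image_subset_image hsub)⟩
    intro j b' bit hbit
    by_cases hz : (j, b') = (i, b)
    · simp only [hz, Function.update_self] at hbit
      cases hbit
    · simp only [Function.update_of_ne hz] at hbit
      exact hvC j b' bit hbit
  · rintro m ⟨v, hvU, hvC, hvA, hvI⟩ K hK hfl
    have key : ∀ i u, (∀ l ∈ neqClause c k i u, m l.1 = some (!l.2)) →
        i ∈ auxHeavy t m ∧ v i = u := by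
      intro i u h
      have h1 : ∀ b, m (i, b) = some (vbit u b) := by
        intro b
        have := h ((i, b), ! vbit u b) (Finset.mem_image.2 ⟨b, Finset.mem_univ _, rfl⟩)
        simpa using this
      constructor
      · refine Finset.mem_filter.2 ⟨Finset.mem_univ _, ?_⟩
        simpa [h1] using htk
      · exact aux_vbit_inj fun b => hvC i b _ (h1 b)
    rcases hK with ⟨i, j, hij, u, rfl⟩ | ⟨i, j, hij, u, w, huw, hadj, rfl⟩
    · have h1 := key i u fun l hl => hfl l (Finset.mem_union_left _ hl)
      have h2 := key j u fun l hl => hfl l (Finset.mem_union_right _ hl)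
      have := hvA i h1.1 j h2.1 hij
      rw [h1.2, h2.2] at this
      exact G.irrefl this
    · have h1 := key i u fun l hl => hfl l (Finset.mem_union_left _ hl)
      have h2 := key j w fun l hl => hfl l (Finset.mem_union_right _ hl)
      have := hvA i h1.1 j h2.1 hij
      rw [h1.2, h2.2] at this
      exact hadj this

/-- Fix `c > 0`. There is `ε > 0`, independent of `n` and `G`, such that
for every sufficiently large `k` and every `c`-Ramsey graph `G` on `n = 2^k` vertices, the
Adversary has a strategy in the game on `Clique(G)` winning against every Prover who uses
at most `ε²·k²` memory locations. -/
theorem adversary_wins_ramsey (c : ℝ) (hc : 0 < c) :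
    ∃ ε : ℝ, 0 < ε ∧ ∃ K : ℕ, ∀ k : ℕ, K ≤ k →
      ∀ G : SimpleGraph (Fin (2 ^ k)), IsCRamsey c G →
        AdversaryWinsAgainst (CliqueCNF c G) (ε ^ 2 * (k : ℝ) ^ 2) := by
  obtain ⟨θ, δ, hθ, hδ, hδ8, K, hK⟩ := aux_PR c hc
  obtain ⟨y, τ, hy, hy1, hτ, hτ1, hent⟩ := aux_entropy 1 (θ / 8) one_pos (by positivity)
  have hl2 : 0 < Real.log 2 := Real.log_pos (by norm_num)
  have h2δ : 1 < 2 / δ := by rw [lt_div_iff₀ hδ]; linarith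
  have hlog : 0 < Real.log (2 / δ) := Real.log_pos h2δ
  set ε : ℝ := min (τ / 2) (θ / 4 * Real.log 2 / Real.log (2 / δ)) with hε
  have hε0 : 0 < ε := lt_min (by positivity) (by positivity)
  have hετ : ε ≤ τ / 2 := min_le_left _ _
  have hεθ : ε * Real.log (2 / δ) ≤ θ / 4 * Real.log 2 := by
    have : ε ≤ θ / 4 * Real.log 2 / Real.log (2 / δ) := min_le_right _ _
    rwa [le_div_iff₀ hlog] at this
  refine ⟨ε, hε0, max K (max 1 ⌈4 / θ⌉₊), ?_⟩
  intro k hk G hG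
  obtain ⟨S, hSne, hgood⟩ := hK k (le_trans (le_max_left _ _) hk) G hG
  have hk1 : (1 : ℝ) ≤ k := by
    exact_mod_cast le_trans (le_trans (le_max_left _ _) (le_max_right _ _)) hk
  have hkθ : 4 ≤ θ * k := by
    have h1 : ⌈4 / θ⌉₊ ≤ k := le_trans (le_trans (le_max_right _ _) (le_max_right _ _)) hk
    have h2 := Nat.ceil_le.1 h1
    rw [div_le_iff₀ hθ] at h2
    linarith
  have hfl : (⌊ε * k⌋₊ : ℝ) ≤ ε * k := Nat.floor_le (by positivity)
  have hfl' : ε * k < ⌊ε * k⌋₊ + 1 := Nat.lt_floor_add_one _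
  set t : ℕ := ⌊ε * k⌋₊ with ht
  set P : Finset (Fin k → Option Bool) := Finset.univ.filter fun p =>
      (Finset.univ.filter fun b => (p b).isSome).card ≤ t with hP
  have hSpos : (0 : ℝ) < S.card := by exact_mod_cast Finset.card_pos.2 hSne
  have hPpos : (0 : ℝ) < P.card := by
    have : (fun _ => none) ∈ P := by rw [hP]; simp
    exact_mod_cast Finset.card_pos.2 ⟨_, this⟩
  have hPc : (P.card : ℝ) ≤ (2 : ℝ) ^ (θ / 8 * k) := by
    have h1 := aux_pattern_count k t y hy hy1
    have h2 := hent k t k (by linarith) (by linarith) (by nlinarith)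
    rw [Real.rpow_natCast] at h2
    exact le_of_mul_le_mul_right (h1.trans h2) (by positivity)
  have htk : t < k := by
    have : (t : ℝ) < k := by nlinarith
    exact_mod_cast this
  have h2δt : (2 / δ) ^ t ≤ (2 : ℝ) ^ (θ / 4 * k) := by
    rw [← Real.rpow_natCast, Real.rpow_def_of_pos (by positivity),
      Real.rpow_def_of_pos (by norm_num)]
    apply Real.exp_le_exp.2
    have e1 : Real.log (2 / δ) * t ≤ Real.log (2 / δ) * (ε * k) := by gcongr
    have e2 : ε * Real.log (2 / δ) * k ≤ θ / 4 * Real.log 2 * k := by gcongr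
    linarith
  have h2E : (2 : ℝ) ≤ (2 : ℝ) ^ (θ / 4 * k) := by
    calc (2 : ℝ) = (2 : ℝ) ^ (1 : ℝ) := by simp
      _ ≤ _ := Real.rpow_le_rpow_of_exponent_le (by norm_num) (by linarith)
  have hmain : 2 * (P.card : ℝ) * P.card * (2 / δ) ^ t < (2 : ℝ) ^ (θ * k) := by
    calc 2 * (P.card : ℝ) * P.card * (2 / δ) ^ t
        ≤ (2 : ℝ) ^ (θ / 4 * k) * (2 : ℝ) ^ (θ / 8 * k) * (2 : ℝ) ^ (θ / 8 * k)
          * (2 : ℝ) ^ (θ / 4 * k) := by gcongr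
      _ = (2 : ℝ) ^ (θ / 4 * k + θ / 8 * k + θ / 8 * k + θ / 4 * k) := by
          rw [Real.rpow_add (by norm_num), Real.rpow_add (by norm_num),
            Real.rpow_add (by norm_num)]
      _ < _ := Real.rpow_lt_rpow_of_exponent_lt (by norm_num) (by nlinarith)
  refine aux_game c G S hSne δ ((2 : ℝ) ^ (θ * k)) (ε ^ 2 * (k : ℝ) ^ 2) t t P hP hδ
    (by linarith) (by positivity) htk hgood ?_ ?_
  · rw [div_pow] at hmain
    have hδt : 0 < δ ^ t := by positivity
    have h1 : 2 * (P.card : ℝ) * P.card * 2 ^ t < (2 : ℝ) ^ (θ * k) * δ ^ t := by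
      rw [← mul_div_assoc, div_lt_iff₀ hδt] at hmain
      exact hmain
    have h2 : δ ^ t * ((S.card : ℝ) / (2 * P.card)) * (2 : ℝ) ^ (θ * k)
        = (S.card : ℝ) * ((2 : ℝ) ^ (θ * k) * δ ^ t) / (2 * P.card) := by ring
    rw [h2, lt_div_iff₀ (by positivity)]
    calc 2 ^ t * (P.card : ℝ) * S.card * (2 * P.card)
        = S.card * (2 * (P.card : ℝ) * P.card * 2 ^ t) := by ring
      _ < _ := mul_lt_mul_of_pos_left h1 hSpos
  · intro n hn
    push_cast at hn
    have hek : 0 < ε * k := by positivity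
    have h1 : (n : ℝ) ≤ ε * k := by
      have h2 : (n : ℝ) * (ε * k) ≤ (ε * k) * (ε * k) := by
        have : (n : ℝ) * (ε * k) ≤ n * (t + 1) := by gcongr
        nlinarith
      exact le_of_mul_le_mul_right h2 hek
    exact Nat.le_floor h1
end

section
/- Let S be a finite set, let F be a finite family of subsets of S, and let t ≥ 0 be a real number. Then there exists S* ⊆ S with |S*| ≥ |S| − |F|·t such that for every C ∈ F, either C ∩ S* = ∅ or |C ∩ S*| > t. -/
open Classical
/-- (Cleaning lemma.) Let `S` be a finite set, `F` a finite family of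
subsets of `S`'s ambient type, and `t ≥ 0` a real number. Then there is `S* ⊆ S` with
`|S*| ≥ |S| − |F|·t` such that every `C ∈ F` satisfies `C ∩ S* = ∅` or `|C ∩ S*| > t`. -/
theorem cleaning_lemma {α : Type} [DecidableEq α] (S : Finset α) (F : Finset (Finset α))
    (t : ℝ) (ht : 0 ≤ t) :
    ∃ Sstar : Finset α, Sstar ⊆ S ∧ (S.card : ℝ) - (F.card : ℝ) * t ≤ (Sstar.card : ℝ) ∧
      ∀ C ∈ F, C ∩ Sstar = ∅ ∨ t < ((C ∩ Sstar).card : ℝ) := by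
  induction hn : F.card generalizing S F with
  | zero =>
    refine ⟨S, Finset.Subset.refl _, by simp, ?_⟩
    intro C hC
    rw [Finset.card_eq_zero.mp hn] at hC
    simp at hC
  | succ n ih =>
    by_cases h : ∀ C ∈ F, C ∩ S = ∅ ∨ t < ((C ∩ S).card : ℝ)
    · refine ⟨S, Finset.Subset.refl _, ?_, h⟩
      have : 0 ≤ ((n + 1 : ℕ) : ℝ) * t := by positivity
      linarith
    · push Not at h
      obtain ⟨C, hC, -, hle⟩ := h
      obtain ⟨T, hTS, hcard, hT⟩ := ih (S \ C) (F.erase C)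
        (by rw [Finset.card_erase_of_mem hC, hn]; rfl)
      refine ⟨T, hTS.trans Finset.sdiff_subset, ?_, ?_⟩
      · have h1 : ((S \ C).card : ℝ) + ((C ∩ S).card : ℝ) = S.card := by
          rw [Finset.inter_comm]
          exact_mod_cast Finset.card_sdiff_add_card_inter S C
        push_cast
        linarith
      · intro D hD
        by_cases hDC : D = C
        · left
          subst hDC
          ext x
          simp only [Finset.mem_inter, Finset.notMem_empty, iff_false, not_and]
          intro hx hxT
          exact (Finset.mem_sdiff.mp (hTS hxT)).2 hx
        · exact hT D (Finset.mem_erase.mpr ⟨hDC, hD⟩)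
end

section
/- Fix a constant c > 0. There is a constant ε > 0 such that for every sufficiently large k and every c-Ramsey graph G on n = 2^k vertices, the CNF Clique(G) has no resolution refutation of width at most ε·k²; that is, W(Clique(G)) > ε·k². -/
open Classical
namespace RamseyWidth

/-- small subsets are few -/
lemma card_small_mul {α : Type*} (X : Finset α) (d : ℕ) (x : ℝ) (hx : 0 < x) (hx1 : x ≤ 1) :
    ((X.powerset.filter (fun s => s.card ≤ d)).card : ℝ) * x ^ d ≤ (1 + x) ^ X.card := by
  have h1 : ∑ s ∈ X.powerset, x ^ s.card = (1 + x) ^ X.card := by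
    have := Finset.sum_pow_mul_eq_add_pow x 1 X
    simp only [one_pow, mul_one] at this
    rw [this, add_comm]
  rw [← h1, ← nsmul_eq_mul, ← Finset.sum_const]
  calc _ ≤ ∑ s ∈ X.powerset.filter (fun s => s.card ≤ d), x ^ s.card := by
        apply Finset.sum_le_sum
        intro s hs
        exact pow_le_pow_of_le_one hx.le hx1 (Finset.mem_filter.1 hs).2
    _ ≤ _ := by
        apply Finset.sum_le_sum_of_subset_of_nonneg (Finset.filter_subset _ _)
        intros; positivity

lemma count (C η : ℝ) (hC : 0 < C) (hη : 0 < η) : ∃ θ : ℝ, 0 < θ ∧ ∀ (k d : ℕ) (α : Type)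
    (X : Finset α), (X.card : ℝ) ≤ C * k → (d : ℝ) ≤ θ * k →
    ((X.powerset.filter (fun s => s.card ≤ d)).card : ℝ) ≤ Real.exp (η * k) := by
  obtain ⟨x, hx, hx1, hxC⟩ : ∃ x : ℝ, 0 < x ∧ x ≤ 1 ∧ x * C ≤ η / 2 := by
    refine ⟨min 1 (η / (2 * C)), by positivity, min_le_left _ _, ?_⟩
    calc _ ≤ η / (2 * C) * C := by gcongr; exact min_le_right _ _
      _ = η / 2 := by field_simp
  have hL : 0 ≤ - Real.log x := by
    have := Real.log_nonpos hx.le hx1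
    linarith
  refine ⟨η / (2 * (- Real.log x + 1)), by positivity, ?_⟩
  intro k d α X hX hd
  have h := card_small_mul X d x hx hx1
  have hxd : x ^ d = Real.exp (Real.log x * d) := by
    rw [Real.exp_mul, Real.exp_log hx, Real.rpow_natCast]
  have h2 : (1 + x) ^ X.card ≤ Real.exp (η / 2 * k) := by
    calc (1 + x) ^ X.card ≤ (Real.exp x) ^ X.card := by
          gcongr
          linarith [Real.add_one_le_exp x]
      _ = Real.exp (x * X.card) := by rw [Real.exp_mul, Real.rpow_natCast]
      _ ≤ _ := by
          apply Real.exp_le_exp.2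
          calc x * X.card ≤ x * (C * k) := by gcongr
            _ = x * C * k := by ring
            _ ≤ _ := by gcongr
  have h3 : Real.exp (-(η / 2 * k)) ≤ x ^ d := by
    rw [hxd]
    apply Real.exp_le_exp.2
    have : (- Real.log x) * d ≤ η / 2 * k := by
      calc (- Real.log x) * d ≤ (- Real.log x + 1) * (η / (2 * (- Real.log x + 1)) * k) := by
            gcongr
            linarith
        _ = _ := by
          have : (- Real.log x + 1) ≠ 0 := by positivity
          field_simp
    linarith
  have h4 : ((X.powerset.filter (fun s => s.card ≤ d)).card : ℝ) * Real.exp (-(η / 2 * k))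
      ≤ Real.exp (η / 2 * k) := le_trans (by gcongr) (h.trans h2)
  calc _ = ((X.powerset.filter (fun s => s.card ≤ d)).card : ℝ) * Real.exp (-(η / 2 * k))
        * Real.exp (η / 2 * k) := by rw [mul_assoc, ← Real.exp_add]; simp
    _ ≤ Real.exp (η / 2 * k) * Real.exp (η / 2 * k) := by gcongr
    _ = _ := by rw [← Real.exp_add]; congr 1; ring

/-- Erdos-Szekeres -/
lemma ramsey {V : Type*} (G : SimpleGraph V) : ∀ (n s t : ℕ), s + t = n → ∀ S : Finset V,
    (s + t).choose s ≤ S.card → ∃ T ⊆ S, (T.card = s ∧ G.IsClique (T : Set V)) ∨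
      (T.card = t ∧ Gᶜ.IsClique (T : Set V)) := by
  intro n
  induction n with
  | zero =>
    intro s t h S _
    exact ⟨∅, by simp, Or.inl ⟨by simp; omega, by simp⟩⟩
  | succ n ih =>
    intro s t h S hS
    rcases s with _ | s
    · exact ⟨∅, by simp, Or.inl ⟨by simp, by simp⟩⟩
    rcases t with _ | t
    · exact ⟨∅, by simp, Or.inr ⟨by simp, by simp⟩⟩
    have hpas : (s + 1 + (t + 1)).choose (s + 1)
        = (s + (t + 1)).choose s + (s + 1 + t).choose (s + 1) := by
      have : s + 1 + (t + 1) = (s + t + 1) + 1 := by ring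
      rw [this, Nat.choose_succ_succ]
      congr 2; ring
    have hpos : 0 < (s + 1 + (t + 1)).choose (s + 1) := Nat.choose_pos (by omega)
    obtain ⟨v, hv⟩ : S.Nonempty := Finset.card_pos.1 (by omega)
    set X := (S.erase v).filter (fun w => G.Adj v w) with hX
    set Y := (S.erase v).filter (fun w => ¬ G.Adj v w) with hY
    have hXY : X.card + Y.card = S.card - 1 := by
      rw [hX, hY, Finset.card_filter_add_card_filter_not, Finset.card_erase_of_mem hv]
    by_cases hc : (s + (t + 1)).choose s ≤ X.card
    · obtain ⟨T, hT, h1 | h1⟩ := ih s (t + 1) (by omega) X hc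
      · have hvT : v ∉ T := fun h => by have := hT h; simp [hX] at this
        refine ⟨insert v T, ?_, Or.inl ⟨by rw [Finset.card_insert_of_notMem hvT, h1.1], ?_⟩⟩
        · intro w hw
          rcases Finset.mem_insert.1 hw with rfl | hw
          · exact hv
          · have := hT hw; simp [hX] at this; exact this.1.2
        · rw [Finset.coe_insert, SimpleGraph.isClique_insert]
          refine ⟨h1.2, fun w hw _ => ?_⟩
          have := hT hw; simp [hX] at this; exact this.2
      · refine ⟨T, fun w hw => ?_, Or.inr h1⟩
        have := hT hw; simp [hX] at this; exact this.1.2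
    · obtain ⟨T, hT, h1 | h1⟩ := ih (s + 1) t (by omega) Y (by omega)
      · refine ⟨T, fun w hw => ?_, Or.inl h1⟩
        have := hT hw; simp [hY] at this; exact this.1.2
      · have hvT : v ∉ T := fun h => by have := hT h; simp [hY] at this
        refine ⟨insert v T, ?_, Or.inr ⟨by rw [Finset.card_insert_of_notMem hvT, h1.1], ?_⟩⟩
        · intro w hw
          rcases Finset.mem_insert.1 hw with rfl | hw
          · exact hv
          · have := hT hw; simp [hY] at this; exact this.1.2
        · rw [Finset.coe_insert, SimpleGraph.isClique_insert]
          refine ⟨h1.2, fun w hw hne => ?_⟩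
          have := hT hw; simp [hY] at this
          rw [SimpleGraph.compl_adj]
          exact ⟨hne, this.2⟩

/-- no clique and no independent set of size ⌈ck⌉ -/
def NoHom (c : ℝ) (k : ℕ) {V : Type} (G : SimpleGraph V) : Prop :=
  ∀ T : Finset V, T.card = ⌈c * k⌉₊ →
    ¬ G.IsClique (T : Set V) ∧ ¬ Gᶜ.IsClique (T : Set V)

lemma NoHom.indep_lt {c : ℝ} {k : ℕ} {V : Type} {G : SimpleGraph V} (h : NoHom c k G)
    (T : Finset V) (hT : Gᶜ.IsClique (T : Set V)) : (T.card : ℝ) < c * k := by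
  by_contra hcon
  push Not at hcon
  obtain ⟨T', hT', hc⟩ := Finset.exists_subset_card_eq (Nat.ceil_le.2 hcon)
  exact (h T' hc).2 (hT.subset (by exact_mod_cast hT'))

lemma base (c : ℝ) (hc : 0 < c) : ∃ θ : ℝ, 0 < θ ∧ ∃ K : ℕ, ∀ k : ℕ, K ≤ k →
    ∀ (V : Type) (G : SimpleGraph V), NoHom c k G → ∀ S : Finset V,
      Real.exp (1 / 4 * k) ≤ S.card →
      ∃ T ⊆ S, Gᶜ.IsClique (T : Set V) ∧ θ * k ≤ T.card := by
  obtain ⟨θ', hθ', hcount⟩ := count (c + 2) (1 / 4) (by linarith) (by norm_num)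
  obtain ⟨θ, hθ, hθ1, hθle⟩ : ∃ θ : ℝ, 0 < θ ∧ θ ≤ 1 ∧ θ ≤ θ' :=
    ⟨min 1 θ', by positivity, min_le_left _ _, min_le_right _ _⟩
  refine ⟨θ / 2, by positivity, ⌈2 / θ⌉₊ + 1, ?_⟩
  intro k hk V G hG S hS
  have hk1 : 2 / θ ≤ k := (Nat.le_ceil _).trans (by exact_mod_cast (by omega))
  have hk2 : 2 ≤ θ * k := by rw [div_le_iff₀ hθ] at hk1; linarith
  have hk3 : (1 : ℝ) ≤ k := by exact_mod_cast (by omega)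
  set t := ⌊θ * k⌋₊ with ht
  have ht1 : (t : ℝ) ≤ θ * k := Nat.floor_le (by positivity)
  have ht2 : θ * k < t + 1 := Nat.lt_floor_add_one _
  set s := ⌈c * k⌉₊ with hs
  have hs1 : (s : ℝ) < c * k + 1 := Nat.ceil_lt_add_one (by positivity)
  have hch : (((s + t).choose s : ℕ) : ℝ) ≤ Real.exp (1 / 4 * k) := by
    have h := hcount k t (Fin (s + t)) Finset.univ (by
      simp
      have : θ * k ≤ 1 * k := by gcongr
      nlinarith) (ht1.trans (by gcongr))
    refine le_trans ?_ h
    have h5 : (s + t).choose s = (Finset.powersetCard t (Finset.univ : Finset (Fin (s + t)))).card := by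
      rw [Finset.card_powersetCard, Finset.card_univ, Fintype.card_fin, Nat.choose_symm_add]
    rw [h5]
    norm_cast
    apply Finset.card_le_card
    intro x hx
    simp at hx ⊢
    omega
  obtain ⟨T, hT, h | h⟩ := ramsey G _ s t rfl S (by exact_mod_cast hch.trans hS)
  · exact absurd h.2 (hG T h.1).1
  · refine ⟨T, hT, h.2, ?_⟩
    rw [h.1]
    linarith

set_option maxHeartbeats 1000000 in
lemma step {V : Type} (G : SimpleGraph V) (A I : Finset V) (δ : ℝ) (hδ : 0 < δ) (M : ℝ)
    (hlow : ∀ u ∈ I, ((A.filter (fun w => G.Adj u w)).card : ℝ) ≤ δ * A.card)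
    (hA : 2 * I.card ≤ A.card) (d : ℕ) (hd : 4 * δ * I.card < d + 1)
    (hM : ((I.powerset.filter (fun s => s.card ≤ d)).card : ℝ) ≤ M) :
    ∃ D ⊆ I, D.card ≤ d ∧ ∃ A' ⊆ A \ I, (A.card : ℝ) ≤ A'.card * (4 * M) ∧
      ∀ v ∈ A', I.filter (fun u => G.Adj u v) = D := by
  set P := I.powerset.filter (fun s => s.card ≤ d) with hP
  set tr : V → Finset V := fun v => I.filter (fun u => G.Adj u v) with htr
  have hdc : ∑ v ∈ A, (tr v).card = ∑ u ∈ I, (A.filter (fun w => G.Adj u w)).card := by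
    simp only [htr, Finset.card_filter]
    rw [Finset.sum_comm]
  have hdc2 : ∑ v ∈ A, ((tr v).card : ℝ) ≤ I.card * (δ * A.card) := by
    have : (∑ v ∈ A, ((tr v).card : ℝ)) = ∑ u ∈ I, ((A.filter (fun w => G.Adj u w)).card : ℝ) := by
      exact_mod_cast hdc
    rw [this, ← nsmul_eq_mul, ← Finset.sum_const]
    exact Finset.sum_le_sum hlow
  set Bd := A.filter (fun v => d < (tr v).card) with hBd
  set Gd := (A \ I).filter (fun v => ¬ d < (tr v).card) with hGd
  have hbad : 4 * (Bd.card : ℝ) ≤ A.card := by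
    rcases Finset.eq_empty_or_nonempty I with hI | hI
    · have : Bd = ∅ := by
        rw [hBd, Finset.filter_eq_empty_iff]
        intro v _
        simp [htr, hI]
      rw [this]; simp
    · have hIpos : (0 : ℝ) < I.card := by exact_mod_cast hI.card_pos
      have h1 : (Bd.card : ℝ) * (4 * δ * I.card) ≤ I.card * (δ * A.card) := by
        refine le_trans ?_ hdc2
        rw [← nsmul_eq_mul, ← Finset.sum_const]
        refine le_trans ?_ (Finset.sum_le_sum_of_subset_of_nonneg (Finset.filter_subset (fun v => d < (tr v).card) A)
          (fun _ _ _ => Nat.cast_nonneg _))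
        apply Finset.sum_le_sum
        intro v hv
        have : d + 1 ≤ (tr v).card := (Finset.mem_filter.1 hv).2
        have : ((d : ℝ) + 1) ≤ (tr v).card := by exact_mod_cast this
        linarith
      have h2 : (4 * (Bd.card : ℝ)) * (δ * I.card) ≤ A.card * (δ * I.card) := by linarith
      exact le_of_mul_le_mul_right h2 (by positivity)
  have hgood : (A.card : ℝ) ≤ 4 * Gd.card := by
    have h1 : A ⊆ Gd ∪ (Bd ∪ I) := by
      intro v hv
      simp only [hGd, hBd, Finset.mem_union, Finset.mem_filter, Finset.mem_sdiff]
      tauto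
    have h2 := (Finset.card_le_card h1).trans (Finset.card_union_le _ _)
    have h3 := Finset.card_union_le Bd I
    have h4 : (A.card : ℝ) ≤ Gd.card + (Bd.card + I.card) := by
      exact_mod_cast h2.trans (by omega)
    have h5 : 2 * (I.card : ℝ) ≤ A.card := by exact_mod_cast hA
    linarith
  have hPne : P.Nonempty := ⟨∅, by simp [hP]⟩
  have hmap : ∀ v ∈ Gd, tr v ∈ P := by
    intro v hv
    have := (Finset.mem_filter.1 hv).2
    simp only [hP, Finset.mem_filter, Finset.mem_powerset]
    exact ⟨Finset.filter_subset _ _, by omega⟩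
  have hPpos : (0 : ℝ) < P.card := by exact_mod_cast hPne.card_pos
  obtain ⟨D, hD, hDc⟩ := Finset.exists_le_card_fiber_of_nsmul_le_card_of_maps_to hmap hPne
    (b := (Gd.card : ℝ) / P.card) (by rw [nsmul_eq_mul]; field_simp; exact le_rfl)
  have hD' := Finset.mem_filter.1 hD
  refine ⟨D, Finset.mem_powerset.1 hD'.1, hD'.2, Gd.filter (fun v => tr v = D),
    (Finset.filter_subset _ _).trans (Finset.filter_subset _ _), ?_, ?_⟩
  · rw [div_le_iff₀ hPpos] at hDc
    calc (A.card : ℝ) ≤ 4 * Gd.card := hgood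
      _ ≤ 4 * ((Gd.filter (fun v => tr v = D)).card * P.card) := by gcongr
      _ ≤ 4 * ((Gd.filter (fun v => tr v = D)).card * M) := by gcongr
      _ = _ := by ring
  · intro v hv
    exact (Finset.mem_filter.1 hv).2

lemma lin_le_exp (a b : ℝ) (ha : 0 < a) : ∃ K : ℕ, ∀ k : ℕ, K ≤ k →
    b * k ≤ Real.exp (a * k) := by
  refine ⟨⌈2 * b / a ^ 2⌉₊, fun k hk => ?_⟩
  have h1 : 2 * b / a ^ 2 ≤ k := (Nat.le_ceil _).trans (by exact_mod_cast hk)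
  rw [div_le_iff₀ (by positivity)] at h1
  have h2 := Real.quadratic_le_exp_of_nonneg (x := a * k) (by positivity)
  have hk0 : (0 : ℝ) ≤ k := by positivity
  have : 0 ≤ a * k := by positivity
  nlinarith

/-- every large part of `S` is seen densely by nearly all of `S` -/
def Good {V : Type} (G : SimpleGraph V) (S : Finset V) (δ m : ℝ) : Prop :=
  ∀ A ⊆ S, m ≤ A.card →
    ((S.filter (fun v => ((A.filter (fun w => G.Adj v w)).card : ℝ) < δ * A.card)).card : ℝ) < m

lemma density_lemma (c : ℝ) (hc : 0 < c) : ∃ δ β : ℝ, 0 < δ ∧ δ ≤ 1 / 8 ∧ 0 < β ∧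
    ∃ K : ℕ, ∀ k : ℕ, K ≤ k → ∀ (V : Type) (G : SimpleGraph V) (Z : Finset V),
      Real.exp (1 / 2 * k) ≤ Z.card → NoHom c k G →
      ∃ S : Finset V, Real.exp (1 / 4 * k) ≤ S.card ∧
        Good G S δ (S.card * Real.exp (-(β * k))) := by
  obtain ⟨θ, hθ, K1, hbase⟩ := base c hc
  obtain ⟨r, hr⟩ := pow_unbounded_of_one_lt (c / θ) (show (1 : ℝ) < 3 / 2 by norm_num)
  rw [div_lt_iff₀ hθ] at hr
  set β : ℝ := 1 / (8 * (r + 1)) with hβ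
  have hβ0 : 0 < β := by positivity
  have hβr : r * (2 * β) ≤ 1 / 4 := by
    rw [hβ, mul_one_div, mul_div_assoc', div_le_iff₀ (by positivity)]
    linarith
  obtain ⟨θ2, hθ2, hcount⟩ := count c (β / 2) hc (by positivity)
  obtain ⟨δ, hδ, hδ8, hδc⟩ : ∃ δ : ℝ, 0 < δ ∧ δ ≤ 1 / 8 ∧ 4 * δ * c ≤ θ2 := by
    refine ⟨min (1 / 8) (θ2 / (4 * c)), by positivity, min_le_left _ _, ?_⟩
    calc _ ≤ 4 * (θ2 / (4 * c)) * c := by gcongr; exact min_le_right _ _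
      _ = θ2 := by field_simp
  obtain ⟨K2, hK2⟩ := lin_le_exp (1 / 4) (2 * c) (by norm_num)
  obtain ⟨K3, hK3⟩ := lin_le_exp (β / 2) 4 (by positivity)
  refine ⟨δ, β, hδ, hδ8, hβ0, max (max K1 K2) (max K3 1), ?_⟩
  intro k hk V G Z hZ hG
  simp only [max_le_iff] at hk
  obtain ⟨⟨hk1, hk2⟩, hk3, hk4⟩ := hk
  have hkR : (1 : ℝ) ≤ k := by exact_mod_cast hk4
  by_contra hcon
  push Not at hcon
  have key : ∀ n : ℕ, ∀ S : Finset V, Real.exp ((1 / 4 + n * (2 * β)) * k) ≤ S.card →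
      ∃ T ⊆ S, Gᶜ.IsClique (T : Set V) ∧ (3 / 2) ^ n * (θ * k) ≤ T.card := by
    intro n
    induction n with
    | zero =>
      intro S hS
      simpa using hbase k hk1 V G hG S (by simpa using hS)
    | succ n ih =>
      intro S hS
      have hS4 : Real.exp (1 / 4 * k) ≤ S.card := by
        refine le_trans (Real.exp_le_exp.2 ?_) hS
        gcongr
        have : 0 ≤ ((n + 1 : ℕ) : ℝ) * (2 * β) := by positivity
        linarith
      have hng := hcon S hS4
      unfold Good at hng
      push Not at hng
      obtain ⟨A, hAS, hAc, hBc⟩ := hng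
      set B := S.filter (fun v => ((A.filter (fun w => G.Adj v w)).card : ℝ) < δ * A.card) with hB
      have hm : Real.exp ((1 / 4 + n * (2 * β)) * k) * Real.exp (β * k)
          ≤ S.card * Real.exp (-(β * k)) := by
        calc _ = Real.exp ((1 / 4 + (n + 1 : ℕ) * (2 * β)) * k) * Real.exp (-(β * k)) := by
              rw [← Real.exp_add, ← Real.exp_add]; congr 1; push_cast; ring
          _ ≤ _ := by gcongr
      have hone : 1 ≤ Real.exp (β * k) := Real.one_le_exp (by positivity)
      have hm1 : Real.exp ((1 / 4 + n * (2 * β)) * k) ≤ S.card * Real.exp (-(β * k)) :=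
        le_trans (le_mul_of_one_le_right (by positivity) hone) hm
      obtain ⟨I, hIB, hI, hIc⟩ := ih B (hm1.trans hBc)
      have hIlt := hG.indep_lt I hI
      have hA2 : 2 * I.card ≤ A.card := by
        have h1 : Real.exp (1 / 4 * k) ≤ A.card := by
          refine le_trans (Real.exp_le_exp.2 ?_) (hm1.trans hAc)
          gcongr
          have : 0 ≤ (n : ℝ) * (2 * β) := by positivity
          linarith
        have h2 := hK2 k hk2
        have : (2 : ℝ) * I.card ≤ A.card := by linarith
        exact_mod_cast this
      have hdle : (⌊4 * δ * I.card⌋₊ : ℝ) ≤ 4 * δ * I.card := Nat.floor_le (by positivity)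
      obtain ⟨D, hDI, hDc, A', hA', hA'c, htr⟩ := step G A I δ hδ (Real.exp (β / 2 * k))
        (fun u hu => ((Finset.mem_filter.1 (hIB hu)).2).le) hA2 ⌊4 * δ * I.card⌋₊
        (Nat.lt_floor_add_one _)
        (hcount k _ V I hIlt.le (hdle.trans (by
          calc 4 * δ * I.card ≤ 4 * δ * (c * k) := by gcongr
            _ = 4 * δ * c * k := by ring
            _ ≤ _ := by gcongr)))
      have hA'big : Real.exp ((1 / 4 + n * (2 * β)) * k) ≤ A'.card := by
        have h4 : 4 * Real.exp (β / 2 * k) ≤ Real.exp (β * k) := by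
          have : (4 : ℝ) ≤ Real.exp (β / 2 * k) := le_trans (by linarith) (hK3 k hk3)
          calc _ ≤ Real.exp (β / 2 * k) * Real.exp (β / 2 * k) := by gcongr
            _ = _ := by rw [← Real.exp_add]; congr 1; ring
        have h5 : Real.exp ((1 / 4 + n * (2 * β)) * k) * Real.exp (β * k)
            ≤ A'.card * Real.exp (β * k) :=
          hm.trans (hAc.trans (hA'c.trans (by gcongr)))
        exact le_of_mul_le_mul_right h5 (by positivity)
      obtain ⟨J, hJA, hJ, hJc⟩ := ih A' hA'big
      have hJI : Disjoint J I := by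
        rw [Finset.disjoint_left]
        intro x hx
        exact (Finset.mem_sdiff.1 (hA' (hJA hx))).2
      refine ⟨(I \ D) ∪ J, ?_, ?_, ?_⟩
      · apply Finset.union_subset
        · exact Finset.sdiff_subset.trans (hIB.trans (Finset.filter_subset _ _))
        · exact hJA.trans (hA'.trans (Finset.sdiff_subset.trans hAS))
      · have hcross : ∀ u ∈ I \ D, ∀ v ∈ J, u ≠ v ∧ ¬ G.Adj u v := by
          intro u hu v hv
          obtain ⟨huI, huD⟩ := Finset.mem_sdiff.1 hu
          refine ⟨fun h => Finset.disjoint_left.1 hJI hv (h ▸ huI), fun h => huD ?_⟩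
          rw [← htr v (hJA hv)]
          exact Finset.mem_filter.2 ⟨huI, h⟩
        intro u hu v hv huv
        rw [SimpleGraph.compl_adj]
        refine ⟨huv, ?_⟩
        rw [Finset.mem_coe, Finset.mem_union] at hu hv
        rcases hu with hu | hu <;> rcases hv with hv | hv
        · exact ((SimpleGraph.compl_adj _ _ _).1 (hI (Finset.mem_sdiff.1 hu).1
            (Finset.mem_sdiff.1 hv).1 huv)).2
        · exact (hcross u hu v hv).2
        · exact fun h => (hcross v hv u hu).2 h.symm
        · exact ((SimpleGraph.compl_adj _ _ _).1 (hJ hu hv huv)).2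
      · rw [Finset.card_union_of_disjoint (Finset.disjoint_of_subset_left Finset.sdiff_subset hJI.symm)]
        have h6 : I.card - D.card ≤ (I \ D).card := Finset.le_card_sdiff _ _
        have h7 : (I.card : ℝ) ≤ (I \ D).card + D.card := by exact_mod_cast (by omega)
        have h8 : (D.card : ℝ) ≤ 4 * δ * I.card := le_trans (by exact_mod_cast hDc) hdle
        have h9 : 4 * δ * I.card ≤ 4 * (1 / 8) * I.card := by gcongr
        push_cast
        rw [pow_succ]
        nlinarith
  obtain ⟨T, -, hT, hTc⟩ := key r Z (by
    refine le_trans (Real.exp_le_exp.2 ?_) hZ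
    gcongr
    linarith)
  have := hG.indep_lt T hT
  nlinarith

lemma clean {V ι : Type} (cons : ι → V → Prop) (M : ℝ) (hM : 0 ≤ M) : ∀ (n : ℕ) (Q : Finset ι),
    Q.card = n → ∀ S : Finset V, Q.card * M < S.card → ∃ S' ⊆ S, S'.Nonempty ∧
      ∀ p ∈ Q, (∃ v ∈ S', cons p v) → M ≤ ((S'.filter (cons p)).card : ℝ) := by
  intro n
  induction n with
  | zero =>
    intro Q hQ S hS
    rw [Finset.card_eq_zero] at hQ
    subst hQ
    refine ⟨S, le_rfl, Finset.card_pos.1 ?_, by simp⟩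
    simpa using hS
  | succ n ih =>
    intro Q hQ S hS
    by_cases h : ∀ p ∈ Q, (∃ v ∈ S, cons p v) → M ≤ ((S.filter (cons p)).card : ℝ)
    · refine ⟨S, le_rfl, Finset.card_pos.1 ?_, h⟩
      have : (0 : ℝ) ≤ Q.card * M := by positivity
      exact_mod_cast this.trans_lt hS
    · push Not at h
      obtain ⟨p, hp, -, hlt⟩ := h
      have hc1 : (Q.erase p).card = n := by rw [Finset.card_erase_of_mem hp, hQ]; rfl
      have hs := Finset.card_filter_add_card_filter_not (s := S) (cons p)
      have hs' : ((S.filter (cons p)).card : ℝ) + (S.filter (fun v => ¬ cons p v)).card = S.card := by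
        exact_mod_cast hs
      obtain ⟨S', hS', hne, hall⟩ := ih (Q.erase p) hc1 (S.filter (fun v => ¬ cons p v)) (by
        rw [hc1]
        rw [hQ] at hS
        push_cast at hS
        linarith)
      refine ⟨S', hS'.trans (Finset.filter_subset _ _), hne, ?_⟩
      intro q hq hex
      by_cases hqp : q = p
      · obtain ⟨v, hv, hcv⟩ := hex
        subst hqp
        exact absurd hcv (Finset.mem_filter.1 (hS' hv)).2
      · exact hall q (Finset.mem_erase.2 ⟨hqp, hq⟩) hex

/-- the committed set `U` leaves many common neighbours in each alive pattern, hereditarily -/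
def InvU {V ι : Type} (G : SimpleGraph V) (cons : ι → V → Prop) (P : Finset ι) (S : Finset V)
    (δ : ℝ) (U : Finset V) : Prop :=
  ∀ W ⊆ U, ∀ p ∈ P, (∃ v ∈ S, cons p v) → δ ^ W.card * ((S.filter (cons p)).card : ℝ) ≤
    (((S.filter (cons p)).filter (fun v => ∀ w ∈ W, G.Adj w v)).card : ℝ)

lemma InvU.mono {V ι : Type} {G : SimpleGraph V} {cons : ι → V → Prop} {P : Finset ι}
    {S : Finset V} {δ : ℝ} {U U' : Finset V} (h : InvU G cons P S δ U) (hs : U' ⊆ U) :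
    InvU G cons P S δ U' := fun W hW => h W (hW.trans hs)

lemma extend {V ι : Type} [DecidableEq V] (G : SimpleGraph V) (cons : ι → V → Prop) (P : Finset ι)
    (S₀ S : Finset V) (hS : S ⊆ S₀) (δ m M : ℝ) (T : ℕ) (hδ : 0 < δ) (hδ1 : δ ≤ 1)
    (hm : 0 ≤ m) (hM : 0 ≤ M)
    (hgood : Good G S₀ δ m)
    (hclean : ∀ p ∈ P, (∃ v ∈ S, cons p v) → M ≤ ((S.filter (cons p)).card : ℝ))
    (hbig : 2 ^ T * P.card * m < δ ^ T * M)
    (U : Finset V) (hU : U.card < T) (hinv : InvU G cons P S δ U) (q : ι) (hq : q ∈ P)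
    (hex : ∃ v ∈ S, cons q v) :
    ∃ v ∈ S, cons q v ∧ (∀ u ∈ U, G.Adj u v) ∧ InvU G cons P S δ (insert v U) := by
  set A : Finset V × ι → Finset V :=
    fun x => (S.filter (cons x.2)).filter (fun v => ∀ w ∈ x.1, G.Adj w v) with hA
  set P' := P.filter (fun p => ∃ v ∈ S, cons p v) with hP'
  have hAbig : ∀ W ⊆ U, ∀ p ∈ P', δ ^ T * M ≤ ((A (W, p)).card : ℝ) := by
    intro W hW p hp
    obtain ⟨hp1, hp2⟩ := Finset.mem_filter.1 hp
    refine le_trans ?_ (hinv W hW p hp1 hp2)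
    have hle : δ ^ T ≤ δ ^ W.card :=
      pow_le_pow_of_le_one hδ.le hδ1 ((Finset.card_le_card hW).trans hU.le)
    exact mul_le_mul hle (hclean p hp1 hp2) hM (by positivity)
  have hqP' : q ∈ P' := Finset.mem_filter.2 ⟨hq, hex⟩
  have hP1 : (1 : ℝ) ≤ P.card := by exact_mod_cast Finset.card_pos.2 ⟨q, hq⟩
  have hmle : m ≤ δ ^ T * M := by
    have h2 : (1 : ℝ) ≤ 2 ^ T * P.card := one_le_mul_of_one_le_of_one_le
      (one_le_pow₀ (by norm_num)) hP1
    exact (le_mul_of_one_le_left hm h2).trans hbig.le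
  set bad : Finset V × ι → Finset V := fun x =>
    S₀.filter (fun v => (((A x).filter (fun w => G.Adj v w)).card : ℝ) < δ * (A x).card) with hbad
  set Bad := (U.powerset ×ˢ P').biUnion bad with hBad
  have hAsub : ∀ x, A x ⊆ S₀ := fun x =>
    (Finset.filter_subset _ _).trans ((Finset.filter_subset _ _).trans hS)
  have hBadc : (Bad.card : ℝ) ≤ 2 ^ T * P.card * m := by
    have h1 : (Bad.card : ℝ) ≤ ∑ x ∈ U.powerset ×ˢ P', ((bad x).card : ℝ) := by
      exact_mod_cast Finset.card_biUnion_le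
    have h2 : ∑ x ∈ U.powerset ×ˢ P', ((bad x).card : ℝ) ≤ (U.powerset ×ˢ P').card * m := by
      rw [← nsmul_eq_mul, ← Finset.sum_const]
      apply Finset.sum_le_sum
      intro x hx
      obtain ⟨hx1, hx2⟩ := Finset.mem_product.1 hx
      exact (hgood (A x) (hAsub x)
        (hmle.trans (hAbig x.1 (Finset.mem_powerset.1 hx1) x.2 hx2))).le
    refine h1.trans (h2.trans ?_)
    rw [Finset.card_product, Finset.card_powerset]
    push_cast
    gcongr
    · norm_num
    · exact Finset.filter_subset _ _
  have hlt : Bad.card < (A (U, q)).card := by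
    have := hBadc.trans_lt (hbig.trans_le (hAbig U le_rfl q hqP'))
    exact_mod_cast this
  obtain ⟨v, hvA, hvB⟩ := Finset.exists_mem_notMem_of_card_lt_card hlt
  obtain ⟨hv1, hv2⟩ := Finset.mem_filter.1 hvA
  obtain ⟨hvS, hvq⟩ := Finset.mem_filter.1 hv1
  refine ⟨v, hvS, hvq, hv2, ?_⟩
  intro W' hW' p hp hpex
  by_cases hvW : v ∈ W'
  · have hWU : W'.erase v ⊆ U := by
      intro w hw
      obtain ⟨h1, h2⟩ := Finset.mem_erase.1 hw
      exact (Finset.mem_insert.1 (hW' h2)).resolve_left h1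
    have hnb : v ∉ bad (W'.erase v, p) := fun h => hvB (by
      rw [hBad, Finset.mem_biUnion]
      exact ⟨_, Finset.mem_product.2 ⟨Finset.mem_powerset.2 hWU,
        Finset.mem_filter.2 ⟨hp, hpex⟩⟩, h⟩)
    have hge : δ * ((A (W'.erase v, p)).card : ℝ) ≤
        (((A (W'.erase v, p)).filter (fun w => G.Adj v w)).card : ℝ) := by
      by_contra hc
      push Not at hc
      exact hnb (Finset.mem_filter.2 ⟨hS hvS, hc⟩)
    have hi := hinv _ hWU p hp hpex
    have hcard : W'.card = (W'.erase v).card + 1 := (Finset.card_erase_add_one hvW).symm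
    rw [hcard, pow_succ]
    calc δ ^ (W'.erase v).card * δ * ((S.filter (cons p)).card : ℝ)
        = δ * (δ ^ (W'.erase v).card * ((S.filter (cons p)).card : ℝ)) := by ring
      _ ≤ δ * ((A (W'.erase v, p)).card : ℝ) := by gcongr
      _ ≤ _ := hge
      _ ≤ _ := by
        norm_cast
        apply Finset.card_le_card
        intro w hw
        obtain ⟨hw1, hw2⟩ := Finset.mem_filter.1 hw
        obtain ⟨hw3, hw4⟩ := Finset.mem_filter.1 hw1
        refine Finset.mem_filter.2 ⟨hw3, fun z hz => ?_⟩
        by_cases hzv : z = v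
        · exact hzv ▸ hw2
        · exact hw4 z (Finset.mem_erase.2 ⟨hzv, hz⟩)
  · exact hinv W' (fun w hw => (Finset.mem_insert.1 (hW' hw)).resolve_left
      (fun h => hvW (h ▸ hw))) p hp hpex

/-- vertex `v` is consistent with pattern `p` -/
def cons {k : ℕ} (p : Finset (Fin k × Bool)) (v : Fin (2 ^ k)) : Prop :=
  ∀ l ∈ p, vbit v l.1 = l.2

/-- patterns of size at most `t` -/
def pats (k t : ℕ) : Finset (Finset (Fin k × Bool)) :=
  (Finset.univ : Finset (Fin k × Bool)).powerset.filter (fun s => s.card ≤ t)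

/-- bits of index `i` fixed by the negation of `C` -/
noncomputable def row {c : ℝ} {k : ℕ} (C : Clause (CliqueVar c k)) (i : Fin (numIdx c k)) :
    Finset (Fin k × Bool) :=
  (C.filter (fun l => l.1.1 = i)).image (fun l => (l.1.2, !l.2))

/-- indices with at least `t` fixed bits -/
noncomputable def heavy {c : ℝ} {k : ℕ} (t : ℕ) (C : Clause (CliqueVar c k)) : Finset (Fin (numIdx c k)) :=
  Finset.univ.filter (fun i => t ≤ (row C i).card)

lemma heavy_card {c : ℝ} {k : ℕ} (t : ℕ) (C : Clause (CliqueVar c k)) :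
    (heavy t C).card * t ≤ C.card := by
  rw [← smul_eq_mul, ← Finset.sum_const]
  calc ∑ i ∈ heavy t C, t ≤ ∑ i ∈ heavy t C, (C.filter (fun l => l.1.1 = i)).card := by
        apply Finset.sum_le_sum
        intro i hi
        exact (Finset.mem_filter.1 hi).2.trans Finset.card_image_le
    _ ≤ ∑ i, (C.filter (fun l => l.1.1 = i)).card :=
        Finset.sum_le_sum_of_subset (Finset.subset_univ _)
    _ = C.card := (Finset.card_eq_sum_card_fiberwise (fun _ _ => Finset.mem_coe.2 (Finset.mem_univ _))).symm

lemma mem_row {c : ℝ} {k : ℕ} (C : Clause (CliqueVar c k)) (l) (hl : l ∈ C) :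
    (l.1.2, !l.2) ∈ row C l.1.1 :=
  Finset.mem_image.2 ⟨l, Finset.mem_filter.2 ⟨hl, rfl⟩, rfl⟩

/-- the Adversary's assignment `f` is a valid answer to the negation of `C` -/
def St {c : ℝ} {k : ℕ} (G : SimpleGraph (Fin (2 ^ k))) (S : Finset (Fin (2 ^ k))) (δ : ℝ) (t : ℕ)
    (C : Clause (CliqueVar c k)) (f : Fin (numIdx c k) → Fin (2 ^ k)) : Prop :=
  (∀ i, f i ∈ S) ∧ (∀ l ∈ C, vbit (f l.1.1) l.1.2 = !l.2) ∧
  (∀ i ∈ heavy t C, ∀ j ∈ heavy t C, i ≠ j → G.Adj (f i) (f j)) ∧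
  InvU G cons (pats k t) S δ ((heavy t C).image f)

lemma query {c : ℝ} {k : ℕ} (G : SimpleGraph (Fin (2 ^ k))) (S : Finset (Fin (2 ^ k))) (δ : ℝ)
    (t T : ℕ)
    (hext : ∀ U : Finset (Fin (2 ^ k)), U.card < T → InvU G cons (pats k t) S δ U →
      ∀ q ∈ pats k t, (∃ v ∈ S, cons q v) →
      ∃ v ∈ S, cons q v ∧ (∀ u ∈ U, G.Adj u v) ∧ InvU G cons (pats k t) S δ (insert v U))
    (C C' : Clause (CliqueVar c k)) (f) (hf : St G S δ t C f) (x : CliqueVar c k)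
    (hC' : ∀ l ∈ C', l = (x, !vbit (f x.1) x.2) ∨ l ∈ C) (hT : (heavy t C').card ≤ T) :
    ∃ f', St G S δ t C' f' := by
  obtain ⟨hfS, hfC, hadj, hinv⟩ := hf
  have hfC' : ∀ l ∈ C', vbit (f l.1.1) l.1.2 = !l.2 := by
    intro l hl
    rcases hC' l hl with rfl | h
    · simp
    · exact hfC l h
  have hrow : ∀ j, j ≠ x.1 → row C' j ⊆ row C j := by
    intro j hj y hy
    obtain ⟨l, hl, rfl⟩ := Finset.mem_image.1 hy
    obtain ⟨hl1, rfl⟩ := Finset.mem_filter.1 hl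
    rcases hC' l hl1 with rfl | h
    · exact absurd rfl hj
    · exact mem_row C l h
  have hheavy : ∀ j ∈ heavy t C', j ≠ x.1 → j ∈ heavy t C := by
    intro j hj hne
    exact Finset.mem_filter.2 ⟨Finset.mem_univ _,
      (Finset.mem_filter.1 hj).2.trans (Finset.card_le_card (hrow j hne))⟩
  by_cases hcase : x.1 ∈ heavy t C' ∧ x.1 ∉ heavy t C
  · obtain ⟨hx1, hx2⟩ := hcase
    have hq : row C' x.1 ∈ pats k t := by
      refine Finset.mem_filter.2 ⟨Finset.mem_powerset.2 (Finset.subset_univ _), ?_⟩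
      have hsub : row C' x.1 ⊆ insert (x.2, vbit (f x.1) x.2) (row C x.1) := by
        intro y hy
        obtain ⟨l, hl, rfl⟩ := Finset.mem_image.1 hy
        obtain ⟨hl1, hl2⟩ := Finset.mem_filter.1 hl
        rcases hC' l hl1 with rfl | h
        · simp
        · exact Finset.mem_insert_of_mem (hl2 ▸ mem_row C l h)
      have h1 := (Finset.card_le_card hsub).trans (Finset.card_insert_le _ _)
      have h2 : ¬ t ≤ (row C x.1).card := fun h =>
        hx2 (Finset.mem_filter.2 ⟨Finset.mem_univ _, h⟩)
      omega
    have hqf : cons (row C' x.1) (f x.1) := by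
      intro y hy
      obtain ⟨l, hl, rfl⟩ := Finset.mem_image.1 hy
      obtain ⟨hl1, hl2⟩ := Finset.mem_filter.1 hl
      rw [← hl2]
      exact hfC' l hl1
    have hUsub : ((heavy t C').erase x.1).image f ⊆ (heavy t C).image f := by
      apply Finset.image_subset_image
      intro j hj
      obtain ⟨h1, h2⟩ := Finset.mem_erase.1 hj
      exact hheavy j h2 h1
    have hUcard : (((heavy t C').erase x.1).image f).card < T := by
      refine lt_of_le_of_lt Finset.card_image_le ?_
      rw [Finset.card_erase_of_mem hx1]
      have : 0 < (heavy t C').card := Finset.card_pos.2 ⟨_, hx1⟩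
      omega
    obtain ⟨v, hvS, hvq, hvadj, hvinv⟩ := hext _ hUcard (hinv.mono hUsub) _ hq
      ⟨f x.1, hfS _, hqf⟩
    have hvadj' : ∀ j ∈ heavy t C', j ≠ x.1 → G.Adj (f j) v := fun j hj hne =>
      hvadj _ (Finset.mem_image_of_mem f (Finset.mem_erase.2 ⟨hne, hj⟩))
    refine ⟨Function.update f x.1 v, ?_, ?_, ?_, ?_⟩
    · intro i
      by_cases h : i = x.1
      · subst h; simpa using hvS
      · simpa [Function.update_of_ne h] using hfS i
    · intro l hl
      by_cases h : l.1.1 = x.1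
      · rw [h, Function.update_self]
        exact hvq (l.1.2, !l.2) (h ▸ mem_row C' l hl)
      · rw [Function.update_of_ne h]
        exact hfC' l hl
    · intro i hi j hj hij
      by_cases h : i = x.1
      · have h' : j ≠ x.1 := fun h2 => hij (h.trans h2.symm)
        rw [h, Function.update_self, Function.update_of_ne h']
        exact (hvadj' j hj h').symm
      · rw [Function.update_of_ne h]
        by_cases h' : j = x.1
        · rw [h', Function.update_self]
          exact hvadj' i hi h
        · rw [Function.update_of_ne h']
          exact hadj i (hheavy i hi h) j (hheavy j hj h') hij
    · refine hvinv.mono ?_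
      intro y hy
      obtain ⟨j, hj, rfl⟩ := Finset.mem_image.1 hy
      by_cases h : j = x.1
      · rw [h, Function.update_self]; exact Finset.mem_insert_self _ _
      · rw [Function.update_of_ne h]
        exact Finset.mem_insert_of_mem (Finset.mem_image_of_mem f (Finset.mem_erase.2 ⟨h, hj⟩))
  · have hsub : heavy t C' ⊆ heavy t C := by
      intro j hj
      by_cases h : j = x.1
      · subst h
        by_contra h2
        exact hcase ⟨hj, h2⟩
      · exact hheavy j hj h
    exact ⟨f, hfS, hfC', fun i hi j hj => hadj i (hsub hi) j (hsub hj),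
      hinv.mono (Finset.image_subset_image hsub)⟩

lemma vbit_ext {k : ℕ} (u v : Fin (2 ^ k)) (h : ∀ b, vbit u b = vbit v b) : u = v := by
  apply Fin.ext
  apply Nat.eq_of_testBit_eq
  intro b
  by_cases hb : b < k
  · exact h ⟨b, hb⟩
  · have h2 : 2 ^ k ≤ 2 ^ b := Nat.pow_le_pow_right (by norm_num) (by omega)
    rw [Nat.testBit_lt_two_pow (u.2.trans_le h2), Nat.testBit_lt_two_pow (v.2.trans_le h2)]

lemma st_neq {c : ℝ} {k : ℕ} {G : SimpleGraph (Fin (2 ^ k))} {S : Finset (Fin (2 ^ k))} {δ : ℝ}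
    {t : ℕ} (ht : t ≤ k) {C : Clause (CliqueVar c k)} {f} (hf : St G S δ t C f) (i u)
    (hsub : neqClause c k i u ⊆ C) : f i = u ∧ i ∈ heavy t C := by
  have hmem : ∀ b, (((i, b) : CliqueVar c k), ! vbit u b) ∈ C := fun b =>
    hsub (Finset.mem_image.2 ⟨b, Finset.mem_univ _, rfl⟩)
  constructor
  · apply vbit_ext
    intro b
    simpa using hf.2.1 _ (hmem b)
  · refine Finset.mem_filter.2 ⟨Finset.mem_univ _, ?_⟩
    have h1 : (Finset.univ : Finset (Fin k)).image (fun b => (b, vbit u b)) ⊆ row C i := by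
      intro y hy
      obtain ⟨b, -, rfl⟩ := Finset.mem_image.1 hy
      simpa using mem_row C _ (hmem b)
    have h2 := Finset.card_le_card h1
    rw [Finset.card_image_of_injective _ (fun a b h => (Prod.ext_iff.1 h).1), Finset.card_univ,
      Fintype.card_fin] at h2
    omega

lemma no_st {c : ℝ} {k : ℕ} {G : SimpleGraph (Fin (2 ^ k))} {S : Finset (Fin (2 ^ k))} {δ : ℝ}
    {t : ℕ} (ht : t ≤ k) {C : Clause (CliqueVar c k)} (hC : C ∈ CliqueCNF c G) {f}
    (hf : St G S δ t C f) : False := by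
  rcases hC with ⟨i, j, hij, v, h⟩ | ⟨i, j, hij, u, v, huv, hadj, h⟩
  · obtain ⟨h1, h2⟩ := st_neq ht hf i v (by rw [h]; exact Finset.subset_union_left)
    obtain ⟨h3, h4⟩ := st_neq ht hf j v (by rw [h]; exact Finset.subset_union_right)
    have := hf.2.2.1 i h2 j h4 hij
    rw [h1, h3] at this
    exact G.irrefl this
  · obtain ⟨h1, h2⟩ := st_neq ht hf i u (by rw [h]; exact Finset.subset_union_left)
    obtain ⟨h3, h4⟩ := st_neq ht hf j v (by rw [h]; exact Finset.subset_union_right)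
    have := hf.2.2.1 i h2 j h4 hij
    rw [h1, h3] at this
    exact hadj this

lemma le_foldr_max (L : List ℕ) (a : ℕ) (h : a ∈ L) : a ≤ L.foldr max 0 := by
  induction L with
  | nil => simp at h
  | cons b L ih =>
    rcases List.mem_cons.1 h with rfl | h
    · simp
    · simpa using Or.inr (ih h)

lemma game {c : ℝ} {k : ℕ} (G : SimpleGraph (Fin (2 ^ k))) (S : Finset (Fin (2 ^ k)))
    (hS : S.Nonempty) (δ : ℝ) (t T : ℕ) (ht : 1 ≤ t) (htk : t ≤ k)
    (hext : ∀ U : Finset (Fin (2 ^ k)), U.card < T → InvU G cons (pats k t) S δ U →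
      ∀ q ∈ pats k t, (∃ v ∈ S, cons q v) →
      ∃ v ∈ S, cons q v ∧ (∀ u ∈ U, G.Adj u v) ∧ InvU G cons (pats k t) S δ (insert v U))
    (R : Refutation (CliqueCNF c G)) : T * t ≤ R.width := by
  by_contra hw
  push Not at hw
  have hheavy : ∀ i : Fin R.clauses.length, (heavy t (R.clauses.get i)).card ≤ T := by
    intro i
    have h1 : (R.clauses.get i).card ≤ R.width :=
      le_foldr_max _ _ (List.mem_map.2 ⟨_, List.get_mem _ _, rfl⟩)
    have h2 := heavy_card t (R.clauses.get i)
    exact (Nat.lt_of_mul_lt_mul_right (a := t) (by omega)).le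
  have key : ∀ n : ℕ, ∀ i : Fin R.clauses.length, i.1 = n →
      ∀ f, ¬ St G S δ t (R.clauses.get i) f := by
    intro n
    induction n using Nat.strong_induction_on with
    | _ n ih =>
      intro i hi f hf
      rcases R.valid i with h | ⟨j, l, hj, hl, x, A, B, h1, h2, h3⟩
      · exact no_st htk h hf
      · by_cases hb : vbit (f x.1) x.2 = true
        · obtain ⟨f', hf'⟩ := query G S δ t T hext _ (R.clauses.get l) f hf x (by
            intro y hy
            rw [h2, Finset.mem_insert] at hy
            rcases hy with rfl | hy
            · left; simp [hb]
            · right; rw [h3]; exact Finset.mem_union_right _ hy) (hheavy l)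
          exact ih l.1 (hi ▸ hl) l rfl f' hf'
        · obtain ⟨f', hf'⟩ := query G S δ t T hext _ (R.clauses.get j) f hf x (by
            intro y hy
            rw [h1, Finset.mem_insert] at hy
            rcases hy with rfl | hy
            · left; simp [hb]
            · right; rw [h3]; exact Finset.mem_union_left _ hy) (hheavy j)
          exact ih j.1 (hi ▸ hj) j rfl f' hf'
  obtain ⟨v, hv⟩ := hS
  have hpos : 0 < R.clauses.length := List.length_pos_iff.2 R.nonempty
  refine key _ ⟨R.clauses.length - 1, by omega⟩ rfl (fun _ => v) ?_
  have hlast : R.clauses.get ⟨R.clauses.length - 1, by omega⟩ = ∅ := by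
    rw [← R.last_empty, List.getLast_eq_getElem]; rfl
  rw [hlast]
  have hh : heavy t (∅ : Clause (CliqueVar c k)) = ∅ := by
    simp [heavy, row]
    omega
  refine ⟨fun _ => hv, by simp, by simp [hh], ?_⟩
  rw [hh]
  intro W hW p _ _
  simp at hW
  subst hW
  simp

end RamseyWidth

/-- Fix `c > 0`. There is `ε > 0` such that for every sufficiently large
`k` and every `c`-Ramsey graph `G` on `n = 2^k` vertices, `Clique(G)` has no resolution
refutation of width at most `ε·k²`; that is, `W(Clique(G)) > ε·k²`. -/
theorem clique_width_lower_bound (c : ℝ) (hc : 0 < c) :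
    ∃ ε : ℝ, 0 < ε ∧ ∃ K : ℕ, ∀ k : ℕ, K ≤ k →
      ∀ G : SimpleGraph (Fin (2 ^ k)), IsCRamsey c G →
        ∀ R : Refutation (CliqueCNF c G), ε * (k : ℝ) ^ 2 < (R.width : ℝ) := by
  obtain ⟨δ, β, hδ, hδ8, hβ, K1, hdens⟩ := RamseyWidth.density_lemma c hc
  obtain ⟨θ, hθ, hcount⟩ := RamseyWidth.count 2 (β / 8) (by norm_num) (by positivity)
  obtain ⟨ε₁, hε₁, hε₁1, hε₁θ⟩ : ∃ ε : ℝ, 0 < ε ∧ ε ≤ 1 ∧ ε ≤ θ :=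
    ⟨min 1 θ, by positivity, min_le_left _ _, min_le_right _ _⟩
  have hlog : 0 < Real.log (2 / δ) := Real.log_pos (by rw [lt_div_iff₀ hδ]; linarith)
  set ε₂ : ℝ := β / (8 * Real.log (2 / δ)) with hε₂d
  have hε₂ : 0 < ε₂ := by positivity
  refine ⟨ε₁ * ε₂ / 8, by positivity, max K1 (max ⌈2 / ε₁⌉₊ (max ⌈2 / ε₂⌉₊ 1)), ?_⟩
  intro k hk G hG R
  simp only [max_le_iff] at hk
  obtain ⟨hk1, hk2, hk3, hk4⟩ := hk
  have hkR : (1 : ℝ) ≤ k := by exact_mod_cast hk4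
  have hk2' : 2 ≤ ε₁ * k := by
    have := Nat.ceil_le.1 hk2
    rw [div_le_iff₀ hε₁] at this; linarith
  have hk3' : 2 ≤ ε₂ * k := by
    have := Nat.ceil_le.1 hk3
    rw [div_le_iff₀ hε₂] at this; linarith
  have hNo : RamseyWidth.NoHom c k G := by
    intro T hT
    have hlogb : Real.logb 2 ((2 ^ k : ℕ) : ℝ) = k := by
      push_cast
      rw [← Real.rpow_natCast, Real.logb_rpow (by norm_num) (by norm_num)]
    unfold IsCRamsey at hG
    rw [hlogb] at hG
    exact ⟨fun h => hG ⟨T, hT, Or.inl h⟩, fun h => hG ⟨T, hT, Or.inr h⟩⟩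
  obtain ⟨S₀, hS₀, hgood⟩ := hdens k hk1 _ G Finset.univ (by
    rw [Finset.card_univ, Fintype.card_fin]
    push_cast
    have h2 : (2 : ℝ) ^ k = Real.exp (Real.log 2 * k) := by
      rw [Real.exp_mul, Real.exp_log (by norm_num), Real.rpow_natCast]
    rw [h2]
    apply Real.exp_le_exp.2
    gcongr
    linarith [Real.log_two_gt_d9]) hNo
  set t := ⌊ε₁ * k⌋₊ with ht
  set T := ⌊ε₂ * k⌋₊ with hTd
  have ht1 : (t : ℝ) ≤ ε₁ * k := Nat.floor_le (by positivity)
  have ht2 : ε₁ * k < t + 1 := Nat.lt_floor_add_one _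
  have hT1 : (T : ℝ) ≤ ε₂ * k := Nat.floor_le (by positivity)
  have hT2 : ε₂ * k < T + 1 := Nat.lt_floor_add_one _
  have htk : t ≤ k := by
    have : (t : ℝ) ≤ k := ht1.trans (by nlinarith)
    exact_mod_cast this
  have ht0 : 1 ≤ t := by
    have : (1 : ℝ) ≤ t := by linarith
    exact_mod_cast this
  have hP : ((RamseyWidth.pats k t).card : ℝ) ≤ Real.exp (β / 8 * k) := by
    refine hcount k t _ Finset.univ ?_ (ht1.trans (by gcongr))
    rw [Finset.card_univ, Fintype.card_prod, Fintype.card_fin, Fintype.card_bool]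
    push_cast
    linarith
  have hS₀pos : (0 : ℝ) < S₀.card := (Real.exp_pos _).trans_le hS₀
  have hβk : 0 < β * k := by positivity
  set M : ℝ := S₀.card * Real.exp (-(β / 2 * k)) with hM
  set m : ℝ := S₀.card * Real.exp (-(β * k)) with hm
  obtain ⟨S, hSS, hSne, hclean⟩ := RamseyWidth.clean (RamseyWidth.cons (k := k)) M (by positivity) _
    (RamseyWidth.pats k t) rfl S₀ (by
      calc ((RamseyWidth.pats k t).card : ℝ) * M ≤ Real.exp (β / 8 * k) * M := by gcongr
        _ = S₀.card * Real.exp (β / 8 * k - β / 2 * k) := by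
          rw [hM, sub_eq_add_neg, Real.exp_add]; ring
        _ < S₀.card * 1 := by
          gcongr
          rw [Real.exp_lt_one_iff]
          linarith
        _ = _ := mul_one _)
  have hpow : (2 : ℝ) ^ T ≤ δ ^ T * Real.exp (β / 8 * k) := by
    have h1 : (2 / δ) ^ T ≤ Real.exp (β / 8 * k) := by
      have : (2 / δ) ^ T = Real.exp (Real.log (2 / δ) * T) := by
        rw [Real.exp_mul, Real.exp_log (by positivity), Real.rpow_natCast]
      rw [this]
      apply Real.exp_le_exp.2
      calc Real.log (2 / δ) * T ≤ Real.log (2 / δ) * (ε₂ * k) := by gcongr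
        _ = _ := by rw [hε₂d]; field_simp
    calc (2 : ℝ) ^ T = δ ^ T * (2 / δ) ^ T := by rw [← mul_pow]; congr 1; field_simp
      _ ≤ _ := by gcongr
  have hbig : 2 ^ T * ((RamseyWidth.pats k t).card : ℝ) * m < δ ^ T * M := by
    calc 2 ^ T * ((RamseyWidth.pats k t).card : ℝ) * m
        ≤ (δ ^ T * Real.exp (β / 8 * k)) * Real.exp (β / 8 * k) * m := by gcongr
      _ = δ ^ T * (S₀.card * Real.exp (β / 8 * k + β / 8 * k + -(β * k))) := by
        rw [hm, Real.exp_add, Real.exp_add]; ring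
      _ < δ ^ T * (S₀.card * Real.exp (-(β / 2 * k))) := by
        gcongr
        linarith
  have hg := RamseyWidth.game G S hSne δ t T ht0 htk
    (fun U hU hinv q hq hex => RamseyWidth.extend G RamseyWidth.cons (RamseyWidth.pats k t) S₀ S
      hSS δ m M T hδ (by linarith) (by positivity) (by positivity) hgood hclean hbig U hU hinv q
      hq hex) R
  have hg' : (T : ℝ) * t ≤ R.width := by exact_mod_cast hg
  refine lt_of_lt_of_le ?_ hg'
  have h1 : ε₁ * k / 2 ≤ t := by linarith
  have h2 : ε₂ * k / 2 ≤ T := by linarith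
  calc ε₁ * ε₂ / 8 * (k : ℝ) ^ 2 < (ε₂ * k / 2) * (ε₁ * k / 2) := by
        have : 0 < ε₁ * ε₂ * (k : ℝ) ^ 2 := by positivity
        nlinarith
    _ ≤ _ := by gcongr
end
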